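/- arXiv:1707.04843 — 3 statements merged into one kernel-verified Lean document; each statement's English description precedes it below -/
import Mathlib

section
/- Let 𝕂 be ℝ or ℂ, m, n ≥ 1, ε, η ≥ 1, d := ε+η+1. Let λM_1+M_0 be a pencil of size (η+1)m×(ε+1)n, let L(λ) be the associated (ε,n,η,m)-block Kronecker pencil, and let P(λ) := (Λ_η(λ)ᵀ⊗I_m)(λM_1+M_0)(Λ_ε(λ)⊗I_n) ∈ 𝕂[λ]^{m×n}, a matrix polynomial of grade d. If ΔL(λ) is any pencil of the same size as L(λ) with ‖ΔL(λ)‖_F < (√2−1)²·(1/d^{5/2})·1/(1+‖λM_1+M_0‖_F), then there exists a matrix polynomial ΔP(λ) ∈ 𝕂[λ]^{m×n} of grade d such that L(λ)+ΔL(λ) is a strong linearization of P(λ)+ΔP(λ) regarded as a polynomial of grade d, and ‖ΔP(λ)‖_F ≤ 14·d^{5/2}·(1 + ‖λM_1+M_0‖_F + ‖λM_1+M_0‖_F²)·‖ΔL(λ)‖_F. -/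
open Polynomial Matrix
open scoped Kronecker

/-- Euclidean norm of a (finitely indexed) vector over `𝕂 = ℝ` or `ℂ`. -/
noncomputable def evnorm {𝕂 : Type*} [RCLike 𝕂] {ι : Type*} [Fintype ι] (x : ι → 𝕂) : ℝ :=
  Real.sqrt (∑ i, ‖x i‖ ^ 2)

/-- Frobenius norm of a constant matrix over `𝕂 = ℝ` or `ℂ`. -/
noncomputable def frobNorm {𝕂 : Type*} [RCLike 𝕂] {ι κ : Type*} [Fintype ι] [Fintype κ]
    (A : Matrix ι κ 𝕂) : ℝ :=
  Real.sqrt (∑ i, ∑ j, ‖A i j‖ ^ 2)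

/-- Spectral norm (largest singular value; `ℓ²→ℓ²` operator norm) of a constant matrix:
the least `c ≥ 0` with `‖Ax‖₂ ≤ c‖x‖₂` for all `x`. -/
noncomputable def specNorm {𝕂 : Type*} [RCLike 𝕂] {ι κ : Type*} [Fintype ι] [Fintype κ]
    (A : Matrix ι κ 𝕂) : ℝ :=
  sInf {c : ℝ | 0 ≤ c ∧ ∀ x : κ → 𝕂, evnorm (A.mulVec x) ≤ c * evnorm x}

/-- Frobenius norm of a matrix polynomial `P(λ) = Σ_i P_i λ^i`:
`‖P‖_F = sqrt(Σ_i ‖P_i‖_F²)` (sum over all nonzero coefficients; independent of the grade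
used to represent `P`). -/
noncomputable def polyFrob {𝕂 : Type*} [RCLike 𝕂] {ι κ : Type*} [Fintype ι] [Fintype κ]
    (P : Matrix ι κ (Polynomial 𝕂)) : ℝ :=
  Real.sqrt (∑ i, ∑ j, ∑ k ∈ (P i j).support, ‖(P i j).coeff k‖ ^ 2)

/-- The `k×(k+1)` pencil `L_k(λ)` with `-1` on the main diagonal and `λ` on the superdiagonal. -/
noncomputable def Lk (R : Type*) [CommRing R] (k : ℕ) :
    Matrix (Fin k) (Fin (k + 1)) (Polynomial R) :=
  Matrix.of fun i j =>
    if (j : ℕ) = (i : ℕ) then -1 else if (j : ℕ) = (i : ℕ) + 1 then Polynomial.X else 0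

/-- The `(k+1)×1` vector polynomial `Λ_k(λ) = (λ^k, λ^{k-1}, …, λ, 1)ᵀ`. -/
noncomputable def Lam (R : Type*) [CommRing R] (k : ℕ) :
    Matrix (Fin (k + 1)) (Fin 1) (Polynomial R) :=
  Matrix.of fun i _ => Polynomial.X ^ (k - (i : ℕ))

/-- The `(ε,n,η,m)`-block Kronecker pencil
`L(λ) = [[λM₁+M₀, L_η(λ)ᵀ⊗I_m],[L_ε(λ)⊗I_n, 0]]`, whose `(1,1)` block is the pencil `M`. -/
noncomputable def blockKron (R : Type*) [CommRing R] (ε n η m : ℕ)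
    (M : Matrix (Fin (η + 1) × Fin m) (Fin (ε + 1) × Fin n) (Polynomial R)) :
    Matrix ((Fin (η + 1) × Fin m) ⊕ (Fin ε × Fin n))
      ((Fin (ε + 1) × Fin n) ⊕ (Fin η × Fin m)) (Polynomial R) :=
  Matrix.fromBlocks M
    ((Lk R η).transpose ⊗ₖ (1 : Matrix (Fin m) (Fin m) (Polynomial R)))
    ((Lk R ε) ⊗ₖ (1 : Matrix (Fin n) (Fin n) (Polynomial R))) 0

/-- `Q(λ) := (Λ_η(λ)ᵀ⊗I_m)·(λM₁+M₀)·(Λ_ε(λ)⊗I_n)`, the `m×n` matrix polynomial associated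
with the `(1,1)` block `M` of a block Kronecker pencil. -/
noncomputable def QpolyOf (R : Type*) [CommRing R] (ε n η m : ℕ)
    (M : Matrix (Fin (η + 1) × Fin m) (Fin (ε + 1) × Fin n) (Polynomial R)) :
    Matrix (Fin 1 × Fin m) (Fin 1 × Fin n) (Polynomial R) :=
  ((Lam R η).transpose ⊗ₖ (1 : Matrix (Fin m) (Fin m) (Polynomial R))) * M *
    ((Lam R ε) ⊗ₖ (1 : Matrix (Fin n) (Fin n) (Polynomial R)))

/-- `L` is a linearization of `P` with identity block of size `s`: there are unimodular
matrix polynomials `U, V` with `U·L·V = diag(I_s, P)` (up to a bijective relabelling of the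
row and column indices of `L`). -/
def IsLinearizationWith {F : Type*} [Field F] {R C ι κ : Type*}
    [Fintype R] [Fintype C] [DecidableEq R] [DecidableEq C]
    (s : ℕ) (L : Matrix R C (Polynomial F)) (P : Matrix ι κ (Polynomial F)) : Prop :=
  ∃ (er : R ≃ (Fin s ⊕ ι)) (ec : C ≃ (Fin s ⊕ κ))
    (U : Matrix R R (Polynomial F)) (V : Matrix C C (Polynomial F)),
    IsUnit U.det ∧ IsUnit V.det ∧
    (U * L * V).submatrix er.symm ec.symm = Matrix.fromBlocks 1 0 0 P

/-- `L` is a linearization of `P`: `U·L·V = diag(I_s, P)` for some `s ≥ 0` and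
unimodular `U, V`. -/
def IsLinearization {F : Type*} [Field F] {R C ι κ : Type*}
    [Fintype R] [Fintype C] [DecidableEq R] [DecidableEq C]
    (L : Matrix R C (Polynomial F)) (P : Matrix ι κ (Polynomial F)) : Prop :=
  ∃ s : ℕ, IsLinearizationWith s L P

/-- The grade-`d` reversal `rev_d P(λ) := λ^d·P(1/λ)` of a matrix polynomial,
computed entrywise by `Polynomial.reflect`. -/
noncomputable def revMat {R : Type*} [CommRing R] {ι κ : Type*} (d : ℕ)
    (P : Matrix ι κ (Polynomial R)) : Matrix ι κ (Polynomial R) :=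
  Matrix.of fun i j => (P i j).reflect d


namespace BK17

section RI
variable {𝕂 : Type*} [RCLike 𝕂] {p q n m : ℕ}

noncomputable def xe (f : Matrix (Fin p × Fin n) (Fin q × Fin m) 𝕂) (a : Fin n) (b : Fin m)
    (z : ℤ × ℤ) : 𝕂 :=
  ∑ i : Fin p, ∑ j : Fin q, if z = ((i : ℤ), (j : ℤ)) then f (i, a) (j, b) else 0

lemma xe_cast (f : Matrix (Fin p × Fin n) (Fin q × Fin m) 𝕂) (a : Fin n) (b : Fin m)
    (i : Fin p) (j : Fin q) (z : ℤ × ℤ) (h1 : z.1 = (i : ℕ)) (h2 : z.2 = (j : ℕ)) :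
    xe f a b z = f (i, a) (j, b) := by
  obtain ⟨z1, z2⟩ := z
  simp only at h1 h2
  subst h1 h2
  unfold xe
  rw [Finset.sum_eq_single i]
  · rw [Finset.sum_eq_single j]
    · simp
    · intro c _ hc
      rw [if_neg]
      simp only [Prod.mk.injEq, not_and]
      intro _ h
      exact hc (Fin.ext (by omega))
    · simp
  · intro c _ hc
    apply Finset.sum_eq_zero
    intro k _
    rw [if_neg]
    simp only [Prod.mk.injEq, not_and]
    intro h
    exact absurd (Fin.ext (by omega)) hc
  · simp

lemma xe_out (f : Matrix (Fin p × Fin n) (Fin q × Fin m) 𝕂) (a : Fin n) (b : Fin m)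
    (z : ℤ × ℤ) (h : z.1 < 0 ∨ (p : ℤ) ≤ z.1 ∨ z.2 < 0 ∨ (q : ℤ) ≤ z.2) :
    xe f a b z = 0 := by
  unfold xe
  apply Finset.sum_eq_zero
  intro i _
  apply Finset.sum_eq_zero
  intro j _
  rw [if_neg]
  rintro rfl
  have := i.2
  have := j.2
  simp only at h
  omega

lemma xe_add (f g : Matrix (Fin p × Fin n) (Fin q × Fin m) 𝕂) (a : Fin n) (b : Fin m)
    (z : ℤ × ℤ) : xe (f + g) a b z = xe f a b z + xe g a b z := by
  unfold xe
  simp only [← Finset.sum_add_distrib]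
  refine Finset.sum_congr rfl fun i _ => Finset.sum_congr rfl fun j _ => ?_
  split_ifs <;> simp

lemma xe_smul (c : 𝕂) (f : Matrix (Fin p × Fin n) (Fin q × Fin m) 𝕂) (a : Fin n) (b : Fin m)
    (z : ℤ × ℤ) : xe (c • f) a b z = c * xe f a b z := by
  unfold xe
  simp only [Finset.mul_sum]
  refine Finset.sum_congr rfl fun i _ => Finset.sum_congr rfl fun j _ => ?_
  split_ifs <;> simp

lemma xe_sq (f : Matrix (Fin p × Fin n) (Fin q × Fin m) 𝕂) (a : Fin n) (b : Fin m)
    (z : ℤ × ℤ) : ‖xe f a b z‖ ^ 2 =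
      ∑ i : Fin p, ∑ j : Fin q, if z = ((i : ℤ), (j : ℤ)) then ‖f (i, a) (j, b)‖ ^ 2 else 0 := by
  by_cases h : ∃ (i : Fin p) (j : Fin q), z = ((i : ℤ), (j : ℤ))
  · obtain ⟨i, j, rfl⟩ := h
    rw [xe_cast f a b i j _ rfl rfl]
    rw [Finset.sum_eq_single i]
    · rw [Finset.sum_eq_single j]
      · simp
      · intro c _ hc
        rw [if_neg]
        simp only [Prod.mk.injEq, not_and]
        intro _ h
        exact hc (Fin.ext (by omega))
      · simp
    · intro c _ hc
      apply Finset.sum_eq_zero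
      intro k _
      rw [if_neg]
      simp only [Prod.mk.injEq, not_and]
      intro h
      exact absurd (Fin.ext (by omega)) hc
    · simp
  · push Not at h
    have : xe f a b z = 0 := by
      unfold xe
      exact Finset.sum_eq_zero fun i _ => Finset.sum_eq_zero fun j _ => if_neg (h i j)
    rw [this]
    symm
    simp only [norm_zero, ne_eq, OfNat.ofNat_ne_zero, not_false_eq_true, zero_pow]
    exact Finset.sum_eq_zero fun i _ => Finset.sum_eq_zero fun j _ => if_neg (h i j)

lemma sum_xe_sq {ι : Type*} [Fintype ι] (ψ : ι → ℤ × ℤ) (hψ : Function.Injective ψ)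
    (f : Matrix (Fin p × Fin n) (Fin q × Fin m) 𝕂) (a : Fin n) (b : Fin m) :
    ∑ y, ‖xe f a b (ψ y)‖ ^ 2 ≤ ∑ i : Fin p, ∑ j : Fin q, ‖f (i, a) (j, b)‖ ^ 2 := by
  classical
  simp only [xe_sq]
  rw [Finset.sum_comm]
  refine Finset.sum_le_sum fun i _ => ?_
  rw [Finset.sum_comm]
  refine Finset.sum_le_sum fun j _ => ?_
  rw [← Finset.sum_filter, Finset.sum_const, nsmul_eq_mul]
  have : (Finset.univ.filter fun y => ψ y = ((i : ℤ), (j : ℤ))).card ≤ 1 := by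
    rw [Finset.card_le_one]
    intro x hx y hy
    simp only [Finset.mem_filter, Finset.mem_univ, true_and] at hx hy
    exact hψ (hx.trans hy.symm)
  have h1 : ((Finset.univ.filter fun y => ψ y = ((i : ℤ), (j : ℤ))).card : ℝ) ≤ 1 := by
    exact_mod_cast this
  nlinarith [sq_nonneg ‖f (i, a) (j, b)‖]

noncomputable def Fz (E : Fin 2 → Matrix (Fin p × Fin n) (Fin q × Fin m) 𝕂) (a : Fin n) (b : Fin m)
    (z : ℤ × ℤ) : 𝕂 :=
  if 1 ≤ z.1 ∧ z.1 + 1 ≤ p then xe (E 0) a b z + xe (E 1) a b (z.1 - 1, z.2) else 0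

noncomputable def Hz (E : Fin 2 → Matrix (Fin p × Fin n) (Fin q × Fin m) 𝕂) (a : Fin n) (b : Fin m)
    (z : ℤ × ℤ) : 𝕂 :=
  if z.1 < p then xe (E 0) a b z else - xe (E 1) a b (z.1 - 1, z.2)

noncomputable def gz (E : Fin 2 → Matrix (Fin p × Fin n) (Fin q × Fin m) 𝕂) (a : Fin n) (b : Fin m)
    (z : ℤ × ℤ) : ℝ :=
  ‖xe (E 0) a b z‖ ^ 2 + ‖xe (E 1) a b (z.1 - 1, z.2)‖ ^ 2

lemma Fz_add (E E' : Fin 2 → Matrix (Fin p × Fin n) (Fin q × Fin m) 𝕂) (a : Fin n) (b : Fin m)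
    (z : ℤ × ℤ) : Fz (E + E') a b z = Fz E a b z + Fz E' a b z := by
  unfold Fz
  simp only [Pi.add_apply, xe_add]
  split_ifs <;> ring

lemma Fz_smul (c : 𝕂) (E : Fin 2 → Matrix (Fin p × Fin n) (Fin q × Fin m) 𝕂) (a : Fin n)
    (b : Fin m) (z : ℤ × ℤ) : Fz (c • E) a b z = c * Fz E a b z := by
  unfold Fz
  simp only [Pi.smul_apply, xe_smul]
  split_ifs <;> ring

lemma Hz_add (E E' : Fin 2 → Matrix (Fin p × Fin n) (Fin q × Fin m) 𝕂) (a : Fin n) (b : Fin m)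
    (z : ℤ × ℤ) : Hz (E + E') a b z = Hz E a b z + Hz E' a b z := by
  unfold Hz
  simp only [Pi.add_apply, xe_add]
  split_ifs <;> ring

lemma Hz_smul (c : 𝕂) (E : Fin 2 → Matrix (Fin p × Fin n) (Fin q × Fin m) 𝕂) (a : Fin n)
    (b : Fin m) (z : ℤ × ℤ) : Hz (c • E) a b z = c * Hz E a b z := by
  unfold Hz
  simp only [Pi.smul_apply, xe_smul]
  split_ifs <;> ring

lemma gz_nonneg (E : Fin 2 → Matrix (Fin p × Fin n) (Fin q × Fin m) 𝕂) (a : Fin n) (b : Fin m)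
    (z : ℤ × ℤ) : 0 ≤ gz E a b z := by unfold gz; positivity

lemma Fz_sq (E : Fin 2 → Matrix (Fin p × Fin n) (Fin q × Fin m) 𝕂) (a : Fin n) (b : Fin m)
    (z : ℤ × ℤ) : ‖Fz E a b z‖ ^ 2 ≤ 2 * gz E a b z := by
  have h0 := gz_nonneg E a b z
  unfold Fz
  split_ifs
  · unfold gz
    have := norm_add_le (xe (E 0) a b z) (xe (E 1) a b (z.1 - 1, z.2))
    have h2 := norm_nonneg (xe (E 0) a b z + xe (E 1) a b (z.1 - 1, z.2))
    nlinarith [sq_nonneg (‖xe (E 0) a b z‖ - ‖xe (E 1) a b (z.1 - 1, z.2)‖)]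
  · simp [h0]

lemma Hz_sq (E : Fin 2 → Matrix (Fin p × Fin n) (Fin q × Fin m) 𝕂) (a : Fin n) (b : Fin m)
    (z : ℤ × ℤ) : ‖Hz E a b z‖ ^ 2 ≤ gz E a b z := by
  unfold Hz gz
  split_ifs
  · nlinarith [sq_nonneg ‖xe (E 1) a b (z.1 - 1, z.2)‖]
  · rw [norm_neg]; nlinarith [sq_nonneg ‖xe (E 0) a b z‖]

lemma sum_gz {ι : Type*} [Fintype ι] (ψ : ι → ℤ × ℤ) (hψ : Function.Injective ψ)
    (E : Fin 2 → Matrix (Fin p × Fin n) (Fin q × Fin m) 𝕂) (a : Fin n) (b : Fin m) :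
    ∑ y, gz E a b (ψ y) ≤ ∑ k, ∑ i : Fin p, ∑ j : Fin q, ‖E k (i, a) (j, b)‖ ^ 2 := by
  unfold gz
  rw [Finset.sum_add_distrib, Fin.sum_univ_two]
  refine add_le_add (sum_xe_sq ψ hψ _ a b)
    (sum_xe_sq (fun y => ((ψ y).1 - 1, (ψ y).2)) ?_ _ a b)
  intro x y h
  apply hψ
  simp only [Prod.mk.injEq, sub_left_inj] at h
  exact Prod.ext h.1 h.2

/-- main scalar estimate -/
lemma sum_main {ι : Type*} [Fintype ι] (K : ℕ) (φ : ℕ → ℤ × ℤ → ℤ × ℤ)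
    (hφ : ∀ k, Function.Injective (φ k)) (σ : ℤ × ℤ → 𝕂) (hσ : ∀ z, ‖σ z‖ = 1)
    (ψ : ι → ℤ × ℤ) (hψ : Function.Injective ψ) (t : 𝕂) (ht : ‖t‖ ≤ 1)
    (E : Fin 2 → Matrix (Fin p × Fin n) (Fin q × Fin m) 𝕂) (a : Fin n) (b : Fin m) :
    ∑ y, ‖σ (ψ y) * ∑ k ∈ Finset.range K, Fz E a b (φ k (ψ y)) + t * Hz E a b (ψ y)‖ ^ 2 ≤
      2 * ((K : ℝ) + 1) ^ 2 * ∑ k, ∑ i : Fin p, ∑ j : Fin q, ‖E k (i, a) (j, b)‖ ^ 2 := by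
  set N := ∑ k, ∑ i : Fin p, ∑ j : Fin q, ‖E k (i, a) (j, b)‖ ^ 2 with hN
  have hN0 : 0 ≤ N := by positivity
  have key : ∀ y, ‖σ (ψ y) * ∑ k ∈ Finset.range K, Fz E a b (φ k (ψ y)) + t * Hz E a b (ψ y)‖ ^ 2
      ≤ ((K : ℝ) + 1) * (∑ k ∈ Finset.range K, 2 * gz E a b (φ k (ψ y)) + gz E a b (ψ y)) := by
    intro y
    have h1 : ‖σ (ψ y) * ∑ k ∈ Finset.range K, Fz E a b (φ k (ψ y)) + t * Hz E a b (ψ y)‖ ≤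
        ∑ k ∈ Finset.range (K + 1), (if k < K then ‖Fz E a b (φ k (ψ y))‖ else ‖Hz E a b (ψ y)‖) := by
      rw [Finset.sum_range_succ]
      simp only [lt_irrefl, if_false]
      refine (norm_add_le _ _).trans (add_le_add ?_ ?_)
      · rw [norm_mul, hσ, one_mul]
        refine (norm_sum_le _ _).trans (Finset.sum_le_sum fun k hk => ?_)
        rw [if_pos (Finset.mem_range.1 hk)]
      · rw [norm_mul]
        exact mul_le_of_le_one_left (norm_nonneg _) ht
    have h2 := pow_le_pow_left₀ (norm_nonneg _) h1 2
    refine h2.trans (sq_sum_le_card_mul_sum_sq.trans ?_)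
    rw [Finset.card_range, Finset.sum_range_succ]
    push_cast
    refine mul_le_mul_of_nonneg_left (add_le_add (Finset.sum_le_sum fun k hk => ?_) ?_) (by positivity)
    · rw [if_pos (Finset.mem_range.1 hk)]
      exact Fz_sq _ _ _ _
    · simpa using Hz_sq E a b (ψ y)
  refine (Finset.sum_le_sum fun y _ => key y).trans ?_
  rw [← Finset.mul_sum, Finset.sum_add_distrib, Finset.sum_comm]
  have h3 : ∑ k ∈ Finset.range K, ∑ y, 2 * gz E a b (φ k (ψ y)) ≤ ∑ k ∈ Finset.range K, 2 * N := by
    refine Finset.sum_le_sum fun k _ => ?_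
    rw [← Finset.mul_sum]
    exact mul_le_mul_of_nonneg_left (sum_gz (fun y => φ k (ψ y)) ((hφ k).comp hψ) E a b) (by norm_num)
  have h4 := sum_gz ψ hψ E a b
  rw [Finset.sum_const, Finset.card_range, nsmul_eq_mul] at h3
  have hK : (0 : ℝ) ≤ K := Nat.cast_nonneg K
  have h5 : ∑ k ∈ Finset.range K, ∑ y, 2 * gz E a b (φ k (ψ y)) + ∑ y, gz E a b (ψ y) ≤
     (2 * K + 2) * N := by
    have := add_le_add h3 h4
    nlinarith
  calc _ ≤ ((K : ℝ) + 1) * ((2 * K + 2) * N) := mul_le_mul_of_nonneg_left h5 (by positivity)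
    _ = _ := by ring

end RI
end BK17

namespace BK17
open scoped Matrix.Norms.Frobenius

section RM
variable {𝕂 : Type*} [RCLike 𝕂] {p q n m : ℕ}

lemma fsq {ι κ : Type*} [Fintype ι] [Fintype κ] (A : Matrix ι κ 𝕂) :
    ‖A‖ ^ 2 = ∑ i, ∑ j, ‖A i j‖ ^ 2 := by
  rw [Matrix.frobenius_norm_def, ← Real.sqrt_eq_rpow, Real.sq_sqrt]
  · simp
  · positivity

/-- Norm of a pencil -/
noncomputable def pn {ι κ : Type*} [Fintype ι] [Fintype κ] (E : Fin 2 → Matrix ι κ 𝕂) : ℝ :=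
  Real.sqrt (∑ k, ‖E k‖ ^ 2)

/-- generic solution operator -/
noncomputable def RM (K : ℕ) (φ : ℕ → ℤ × ℤ → ℤ × ℤ) (σ : ℤ × ℤ → 𝕂) (t : 𝕂) (r c : ℕ) :
    (Fin 2 → Matrix (Fin p × Fin n) (Fin q × Fin m) 𝕂) →ₗ[𝕂]
      Matrix (Fin r × Fin n) (Fin c × Fin m) 𝕂 where
  toFun E := Matrix.of fun x y =>
    σ ((x.1 : ℕ), (y.1 : ℕ)) * ∑ k ∈ Finset.range K, Fz E x.2 y.2 (φ k ((x.1 : ℕ), (y.1 : ℕ)))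
      + t * Hz E x.2 y.2 ((x.1 : ℕ), (y.1 : ℕ))
  map_add' E E' := by
    ext x y
    simp only [Matrix.of_apply, Matrix.add_apply, Fz_add, Hz_add, Finset.sum_add_distrib]
    ring
  map_smul' c E := by
    ext x y
    simp only [Matrix.of_apply, Matrix.smul_apply, Fz_smul, Hz_smul, ← Finset.mul_sum,
      RingHom.id_apply, smul_eq_mul]
    ring

lemma RM_apply (K : ℕ) (φ : ℕ → ℤ × ℤ → ℤ × ℤ) (σ : ℤ × ℤ → 𝕂) (t : 𝕂) (r c : ℕ)
    (E : Fin 2 → Matrix (Fin p × Fin n) (Fin q × Fin m) 𝕂) (x : Fin r × Fin n) (y : Fin c × Fin m) :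
    RM K φ σ t r c E x y = σ ((x.1 : ℕ), (y.1 : ℕ)) *
      ∑ k ∈ Finset.range K, Fz E x.2 y.2 (φ k ((x.1 : ℕ), (y.1 : ℕ)))
      + t * Hz E x.2 y.2 ((x.1 : ℕ), (y.1 : ℕ)) := rfl

lemma RM_norm (K : ℕ) (φ : ℕ → ℤ × ℤ → ℤ × ℤ)
    (hφ : ∀ k, Function.Injective (φ k)) (σ : ℤ × ℤ → 𝕂) (hσ : ∀ z, ‖σ z‖ = 1)
    (t : 𝕂) (ht : ‖t‖ ≤ 1) (r c : ℕ)
    (E : Fin 2 → Matrix (Fin p × Fin n) (Fin q × Fin m) 𝕂) :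
    ‖RM K φ σ t r c E‖ ≤ Real.sqrt 2 * ((K : ℝ) + 1) * pn E := by
  refine (pow_le_pow_iff_left₀ (norm_nonneg _) (by unfold pn; positivity) two_ne_zero).1 ?_
  rw [fsq, mul_pow, mul_pow, Real.sq_sqrt (by norm_num), pn, Real.sq_sqrt (by positivity)]
  simp only [fsq, Fintype.sum_prod_type, RM_apply]
  have e1 : ∀ (u v : ℕ) (f : Fin u → Fin n → Fin v → Fin m → ℝ),
      ∑ i, ∑ a, ∑ j, ∑ b, f i a j b = ∑ a, ∑ b, ∑ i, ∑ j, f i a j b := by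
    intro u v f
    rw [Finset.sum_comm]
    refine Finset.sum_congr rfl fun a _ => ?_
    have : ∀ i, ∑ j, ∑ b, f i a j b = ∑ b, ∑ j, f i a j b := fun i => Finset.sum_comm
    simp only [this]
    rw [Finset.sum_comm]
  simp only [e1]
  have e2 : ∀ (f : Fin 2 → Fin n → Fin m → ℝ),
      ∑ k, ∑ a, ∑ b, f k a b = ∑ a, ∑ b, ∑ k, f k a b := by
    intro f
    rw [Finset.sum_comm]
    refine Finset.sum_congr rfl fun a _ => ?_
    rw [Finset.sum_comm]
  rw [e2, Finset.mul_sum]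
  refine Finset.sum_le_sum fun a _ => ?_
  rw [Finset.mul_sum]
  refine Finset.sum_le_sum fun b _ => ?_
  have := sum_main (ι := Fin r × Fin c) K φ hφ σ hσ (fun y => ((y.1 : ℕ), (y.2 : ℕ))) (by
    rintro ⟨x1, x2⟩ ⟨y1, y2⟩ h
    simp only [Prod.mk.injEq, Nat.cast_inj] at h
    exact Prod.ext (Fin.ext h.1) (Fin.ext h.2)) t ht E a b
  rw [Fintype.sum_prod_type] at this
  exact this

/-- coefficients of `L_p ⊗ I_n` -/
noncomputable def Lc (𝕂 : Type*) [RCLike 𝕂] (p n : ℕ) :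
    Fin 2 → Matrix (Fin p × Fin n) (Fin (p + 1) × Fin n) 𝕂 :=
  ![-((1 : Matrix (Fin (p + 1) × Fin n) (Fin (p + 1) × Fin n) 𝕂).submatrix
      (fun x => (x.1.castSucc, x.2)) id),
    (1 : Matrix (Fin (p + 1) × Fin n) (Fin (p + 1) × Fin n) 𝕂).submatrix
      (fun x => (x.1.succ, x.2)) id]

lemma Lc0_mul {κ : Type*} (B : Matrix (Fin (p + 1) × Fin n) κ 𝕂) (i : Fin p) (a : Fin n) (y : κ) :
    (Lc 𝕂 p n 0 * B) (i, a) y = - B (i.castSucc, a) y := by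
  simp [Lc, Matrix.mul_apply, Matrix.one_apply]

lemma Lc1_mul {κ : Type*} (B : Matrix (Fin (p + 1) × Fin n) κ 𝕂) (i : Fin p) (a : Fin n) (y : κ) :
    (Lc 𝕂 p n 1 * B) (i, a) y = B (i.succ, a) y := by
  simp [Lc, Matrix.mul_apply, Matrix.one_apply]

lemma mul_Lc0T {κ : Type*} (B : Matrix κ (Fin (p + 1) × Fin n) 𝕂) (i : Fin p) (a : Fin n) (y : κ) :
    (B * (Lc 𝕂 p n 0)ᵀ) y (i, a) = - B y (i.castSucc, a) := by
  simp [Lc, Matrix.mul_apply, Matrix.one_apply]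

lemma mul_Lc1T {κ : Type*} (B : Matrix κ (Fin (p + 1) × Fin n) 𝕂) (i : Fin p) (a : Fin n) (y : κ) :
    (B * (Lc 𝕂 p n 1)ᵀ) y (i, a) = B y (i.succ, a) := by
  simp [Lc, Matrix.mul_apply, Matrix.one_apply]

lemma Lc0_apply (x : Fin p × Fin n) (y : Fin (p + 1) × Fin n) :
    Lc 𝕂 p n 0 x y = - if (x.1.castSucc, x.2) = y then 1 else 0 := by
  simp [Lc, Matrix.one_apply]

lemma Lc1_apply (x : Fin p × Fin n) (y : Fin (p + 1) × Fin n) :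
    Lc 𝕂 p n 1 x y = if (x.1.succ, x.2) = y then 1 else 0 := by
  simp [Lc, Matrix.one_apply]

lemma mul_Lc0 {κ : Type*} (A : Matrix κ (Fin p × Fin n) 𝕂) (j : Fin (p + 1)) (a : Fin n) (y : κ) :
    (A * Lc 𝕂 p n 0) y (j, a) = - if h : (j : ℕ) < p then A y (⟨j, h⟩, a) else 0 := by
  simp only [Matrix.mul_apply, Lc0_apply, mul_neg, Finset.sum_neg_distrib, mul_ite, mul_one, mul_zero]
  congr 1
  split_ifs with h
  · rw [Finset.sum_eq_single (⟨j, h⟩, a)]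
    · simp
    · rintro ⟨i, b⟩ _ hb
      rw [if_neg]
      intro hh
      apply hb
      simp only [Prod.mk.injEq] at hh ⊢
      refine ⟨Fin.ext ?_, hh.2⟩
      have := congrArg Fin.val hh.1; simp at this; simp; omega
    · simp
  · apply Finset.sum_eq_zero
    rintro ⟨i, b⟩ _
    rw [if_neg]
    intro hh
    simp only [Prod.mk.injEq] at hh
    apply h
    rw [← hh.1]; simp

lemma mul_Lc1 {κ : Type*} (A : Matrix κ (Fin p × Fin n) 𝕂) (j : Fin (p + 1)) (a : Fin n) (y : κ) :
    (A * Lc 𝕂 p n 1) y (j, a) =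
      if h : 0 < (j : ℕ) then A y (⟨j - 1, by omega⟩, a) else 0 := by
  simp only [Matrix.mul_apply, Lc1_apply, mul_ite, mul_one, mul_zero]
  split_ifs with h
  · rw [Finset.sum_eq_single (⟨j - 1, by omega⟩, a)]
    · rw [if_pos]
      simp only [Prod.mk.injEq, and_true]
      exact Fin.ext (by simp; omega)
    · rintro ⟨i, b⟩ _ hb
      rw [if_neg]
      intro hh
      apply hb
      simp only [Prod.mk.injEq] at hh ⊢
      refine ⟨Fin.ext ?_, hh.2⟩
      have := congrArg Fin.val hh.1; simp at this; simp; omega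
    · simp
  · apply Finset.sum_eq_zero
    rintro ⟨i, b⟩ _
    rw [if_neg]
    intro hh
    simp only [Prod.mk.injEq] at hh
    apply h
    rw [← hh.1]; simp

lemma Fz_out (E : Fin 2 → Matrix (Fin p × Fin n) (Fin q × Fin m) 𝕂) (a : Fin n) (b : Fin m)
    (z : ℤ × ℤ) (h : z.1 < 1 ∨ (p : ℤ) ≤ z.1 ∨ z.2 < 0 ∨ (q : ℤ) ≤ z.2) : Fz E a b z = 0 := by
  unfold Fz
  split_ifs with h1
  · rw [xe_out, xe_out, add_zero]
    · simp only; omega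
    · omega
  · rfl

/-- `F - H = E₁` one row up -/
lemma Fz_sub_Hz (E : Fin 2 → Matrix (Fin p × Fin n) (Fin q × Fin m) 𝕂) (a : Fin n) (b : Fin m)
    (i : Fin p) (j : Fin q) (z : ℤ × ℤ) (h1 : z.1 = (i : ℕ) + 1) (h2 : z.2 = (j : ℕ)) :
    Fz E a b z - Hz E a b z = E 1 (i, a) (j, b) := by
  have hi := i.2
  rw [← xe_cast (E 1) a b i j (z.1 - 1, z.2) (by simp only; omega) h2]
  unfold Fz Hz
  by_cases h : z.1 < p
  · rw [if_pos (by omega), if_pos h]; ring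
  · rw [if_neg (by omega), if_neg h]; ring

lemma Hz_cast (E : Fin 2 → Matrix (Fin p × Fin n) (Fin q × Fin m) 𝕂) (a : Fin n) (b : Fin m)
    (i : Fin p) (j : Fin q) (z : ℤ × ℤ) (h1 : z.1 = (i : ℕ)) (h2 : z.2 = (j : ℕ)) :
    Hz E a b z = E 0 (i, a) (j, b) := by
  have hi := i.2
  unfold Hz
  rw [if_pos (by omega), xe_cast _ _ _ i j _ h1 h2]

/-- Right inverse for `(C, D) ↦ C L_ηᵀ - L_ε D` -/
lemma exists_T (p q n m : ℕ) (hp : 1 ≤ p) : ∃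
    (C : (Fin 2 → Matrix (Fin p × Fin n) (Fin q × Fin m) 𝕂) →ₗ[𝕂]
      Matrix (Fin p × Fin n) (Fin (q + 1) × Fin m) 𝕂)
    (D : (Fin 2 → Matrix (Fin p × Fin n) (Fin q × Fin m) 𝕂) →ₗ[𝕂]
      Matrix (Fin (p + 1) × Fin n) (Fin q × Fin m) 𝕂),
    (∀ E k, C E * (Lc 𝕂 q m k)ᵀ - Lc 𝕂 p n k * D E = E k) ∧
    (∀ E, ‖C E‖ ≤ ((p + q + 1 : ℕ) : ℝ) / Real.sqrt 2 * pn E) ∧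
    (∀ E, ‖D E‖ ≤ ((p + q + 1 : ℕ) : ℝ) / Real.sqrt 2 * pn E) := by
  set K := min (p - 1) q with hK
  set φ : ℕ → ℤ × ℤ → ℤ × ℤ := fun k z => (z.1 + k + 1, z.2 - k - 1) with hφd
  have hφ : ∀ k, Function.Injective (φ k) := by
    rintro k ⟨x1, x2⟩ ⟨y1, y2⟩ h
    simp only [hφd, Prod.mk.injEq] at h
    simp only [Prod.mk.injEq]
    omega
  set G : (Fin 2 → Matrix (Fin p × Fin n) (Fin q × Fin m) 𝕂) → Fin n → Fin m → ℤ × ℤ → 𝕂 :=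
    fun E a b z => ∑ k ∈ Finset.range K, Fz E a b (φ k z) with hG
  have hrec : ∀ E a b (i j : ℕ), j < q →
      G E a b ((i : ℤ), (j : ℤ) + 1) - G E a b ((i : ℤ) + 1, (j : ℤ)) = Fz E a b ((i : ℤ) + 1, (j : ℤ)) := by
    intro E a b i j hj
    simp only [hG, hφd]
    have e1 : ∑ k ∈ Finset.range K, Fz E a b ((i : ℤ) + k + 1, (j : ℤ) + 1 - k - 1) =
        ∑ k ∈ Finset.range K, (fun k : ℕ => Fz E a b ((i : ℤ) + 1 + k, (j : ℤ) - k)) k := by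
      refine Finset.sum_congr rfl fun k _ => ?_
      simp only
      congr 2 <;> ring
    have e2 : ∑ k ∈ Finset.range K, Fz E a b ((i : ℤ) + 1 + k + 1, (j : ℤ) - k - 1) =
        ∑ k ∈ Finset.range K, (fun k : ℕ => Fz E a b ((i : ℤ) + 1 + k, (j : ℤ) - k)) (k + 1) := by
      refine Finset.sum_congr rfl fun k _ => ?_
      simp only
      congr 2 <;> push_cast <;> ring
    rw [e1, e2, ← Finset.sum_sub_distrib, Finset.sum_range_sub']
    rw [Fz_out E a b ((i : ℤ) + 1 + K, _)]
    · simp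
    · simp only; omega
  have hκ : Real.sqrt 2 * ((K : ℝ) + 1) ≤ ((p + q + 1 : ℕ) : ℝ) / Real.sqrt 2 := by
    rw [le_div_iff₀ (by positivity)]
    have h2 : Real.sqrt 2 * Real.sqrt 2 = 2 := Real.mul_self_sqrt (by norm_num)
    have : 2 * (K + 1) ≤ p + q + 1 := by omega
    have h3 : (2 * ((K : ℝ) + 1)) ≤ ((p + q + 1 : ℕ) : ℝ) := by exact_mod_cast this
    nlinarith
  refine ⟨RM K φ (fun _ => 1) 0 p (q + 1), RM K φ (fun _ => 1) 1 (p + 1) q, ?_, ?_, ?_⟩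
  · intro E k
    ext ⟨i, a⟩ ⟨j, b⟩
    rw [Matrix.sub_apply]
    have hi := i.2
    have hj := j.2
    fin_cases k
    · simp only [Fin.zero_eta, Fin.isValue]
      rw [mul_Lc0T, Lc0_mul, RM_apply, RM_apply]
      rw [← Hz_cast E a b i j (((i : ℕ) : ℤ), ((j : ℕ) : ℤ)) rfl rfl]
      simp
    · simp only [Fin.mk_one, Fin.isValue]
      rw [mul_Lc1T, Lc1_mul, RM_apply, RM_apply]
      rw [← Fz_sub_Hz E a b i j ((i : ℕ) + 1, (j : ℕ)) rfl rfl]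
      have := hrec E a b i j hj
      simp only [hG] at this
      rw [← this]
      simp
      ring
  · intro E
    refine (RM_norm K φ hφ _ (by simp) 0 (by simp) _ _ E).trans ?_
    exact mul_le_mul_of_nonneg_right hκ (Real.sqrt_nonneg _)
  · intro E
    refine (RM_norm K φ hφ _ (by simp) 1 (by simp) _ _ E).trans ?_
    exact mul_le_mul_of_nonneg_right hκ (Real.sqrt_nonneg _)

/-- Right inverse for `(A, B) ↦ A L_ε - L_ε B` -/
lemma exists_S (p n : ℕ) : ∃
    (A : (Fin 2 → Matrix (Fin p × Fin n) (Fin (p + 1) × Fin n) 𝕂) →ₗ[𝕂]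
      Matrix (Fin p × Fin n) (Fin p × Fin n) 𝕂)
    (B : (Fin 2 → Matrix (Fin p × Fin n) (Fin (p + 1) × Fin n) 𝕂) →ₗ[𝕂]
      Matrix (Fin (p + 1) × Fin n) (Fin (p + 1) × Fin n) 𝕂),
    (∀ E k, A E * (Lc 𝕂 p n k) - Lc 𝕂 p n k * B E = E k) ∧
    (∀ E, ‖A E‖ ≤ Real.sqrt 2 * ((p : ℝ) + 1) * pn E) ∧
    (∀ E, ‖B E‖ ≤ Real.sqrt 2 * ((p : ℝ) + 1) * pn E) := by
  set φ : ℕ → ℤ × ℤ → ℤ × ℤ := fun k z =>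
    if z.2 ≤ z.1 then (z.1 - k, z.2 - k) else (z.1 + k + 1, z.2 + k + 1) with hφd
  have hφ : ∀ k, Function.Injective (φ k) := by
    rintro k ⟨x1, x2⟩ ⟨y1, y2⟩ h
    simp only [hφd] at h
    split_ifs at h <;> simp only [Prod.mk.injEq] at h ⊢ <;> omega
  set σ : ℤ × ℤ → 𝕂 := fun z => if z.2 ≤ z.1 then -1 else 1 with hσd
  have hσ : ∀ z, ‖σ z‖ = 1 := by
    intro z
    simp only [hσd]
    split_ifs <;> simp
  set G : (Fin 2 → Matrix (Fin p × Fin n) (Fin (p + 1) × Fin n) 𝕂) → Fin n → Fin n → ℤ × ℤ → 𝕂 :=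
    fun E a b z => σ z * ∑ k ∈ Finset.range p, Fz E a b (φ k z) with hG
  have hrec : ∀ E a b (i : ℕ) (j : ℤ), i < p →
      G E a b ((i : ℤ), j - 1) - G E a b ((i : ℤ) + 1, j) = Fz E a b ((i : ℤ) + 1, j) := by
    intro E a b i j hi
    simp only [hG, hφd, hσd]
    by_cases hji : j - 1 ≤ i
    · have hji' : j ≤ (i : ℤ) + 1 := by omega
      simp only [if_pos hji, if_pos hji']
      have e1 : ∑ k ∈ Finset.range p, Fz E a b ((i : ℤ) - k, j - 1 - k) =
          ∑ k ∈ Finset.range p, (fun k : ℕ => Fz E a b ((i : ℤ) + 1 - k, j - k)) (k + 1) := by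
        refine Finset.sum_congr rfl fun k _ => ?_
        simp only
        congr 2 <;> push_cast <;> ring
      have e3 := Finset.sum_range_sub' (fun k : ℕ => Fz E a b ((i : ℤ) + 1 - k, j - k)) p
      rw [Finset.sum_sub_distrib] at e3
      rw [e1]
      rw [Fz_out E a b ((i : ℤ) + 1 - p, _)] at e3
      · simp only [Nat.cast_zero, sub_zero] at e3
        linear_combination e3
      · simp only; omega
    · have hji' : ¬ j ≤ (i : ℤ) + 1 := by omega
      simp only [if_neg hji, if_neg hji']
      have e1 : ∑ k ∈ Finset.range p, Fz E a b ((i : ℤ) + k + 1, j - 1 + k + 1) =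
          ∑ k ∈ Finset.range p, (fun k : ℕ => Fz E a b ((i : ℤ) + 1 + k, j + k)) k := by
        refine Finset.sum_congr rfl fun k _ => ?_
        simp only
        congr 2 <;> push_cast <;> ring
      have e2 : ∑ k ∈ Finset.range p, Fz E a b ((i : ℤ) + 1 + k + 1, j + k + 1) =
          ∑ k ∈ Finset.range p, (fun k : ℕ => Fz E a b ((i : ℤ) + 1 + k, j + k)) (k + 1) := by
        refine Finset.sum_congr rfl fun k _ => ?_
        simp only
        congr 2 <;> push_cast <;> ring
      have e3 := Finset.sum_range_sub' (fun k : ℕ => Fz E a b ((i : ℤ) + 1 + k, j + k)) p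
      rw [Finset.sum_sub_distrib] at e3
      rw [e1, e2]
      rw [Fz_out E a b ((i : ℤ) + 1 + p, _)] at e3
      · simp only [Nat.cast_zero, sub_zero, add_zero] at e3
        linear_combination e3
      · simp only; omega
  have hleft : ∀ E a b (i : ℕ), G E a b ((i : ℤ), -1) = 0 := by
    intro E a b i
    simp only [hG, hφd]
    rw [Finset.sum_eq_zero, mul_zero]
    intro k _
    rw [if_pos (by omega)]
    exact Fz_out _ _ _ _ (by simp only; omega)
  have hright : ∀ E a b (i : ℕ), i < p → G E a b ((i : ℤ), (p : ℤ)) = 0 := by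
    intro E a b i hi
    simp only [hG, hφd]
    rw [Finset.sum_eq_zero, mul_zero]
    intro k _
    rw [if_neg (by omega)]
    exact Fz_out _ _ _ _ (by simp only; push_cast; omega)
  refine ⟨RM p φ σ 0 p p, RM p φ σ 1 (p + 1) (p + 1), ?_,
    RM_norm p φ hφ σ hσ 0 (by simp) _ _, RM_norm p φ hφ σ hσ 1 (by simp) _ _⟩
  intro E k
  ext ⟨i, a⟩ ⟨j, b⟩
  rw [Matrix.sub_apply]
  have hi := i.2
  have hj := j.2
  fin_cases k
  · simp only [Fin.zero_eta, Fin.isValue]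
    rw [mul_Lc0, Lc0_mul, RM_apply]
    rw [← Hz_cast E a b i j (((i : ℕ) : ℤ), ((j : ℕ) : ℤ)) rfl rfl]
    split_ifs with h
    · rw [RM_apply]
      simp
    · have := hright E a b i hi
      simp only [hG] at this
      have hjp : (j : ℕ) = p := by omega
      simp [hjp, this]
  · simp only [Fin.mk_one, Fin.isValue]
    rw [mul_Lc1, Lc1_mul, RM_apply]
    rw [← Fz_sub_Hz E a b i j ((i : ℕ) + 1, (j : ℕ)) rfl rfl]
    have := hrec E a b i (j : ℕ) hi
    rw [← this]
    split_ifs with h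
    · rw [RM_apply]
      have : (((j : ℕ) - 1 : ℕ) : ℤ) = (j : ℕ) - 1 := by omega
      simp only [hG, this]
      simp
      ring
    · have h0 : (j : ℕ) = 0 := by omega
      have h1 := hleft E a b i
      simp only [h0, Nat.cast_zero, zero_sub] at *
      rw [h1]
      simp only [hG]
      simp
      ring

end RM
end BK17

namespace BK17
open scoped Matrix.Norms.Frobenius

section PT
variable {𝕂 : Type*} [RCLike 𝕂]

section basic
variable {ι κ l : Type*} [Fintype ι] [Fintype κ] [Fintype l]

lemma pn_nonneg (E : Fin 2 → Matrix ι κ 𝕂) : 0 ≤ pn E := Real.sqrt_nonneg _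

lemma pn_eq (E : Fin 2 → Matrix ι κ 𝕂) : pn E = ‖WithLp.toLp 2 E‖ := by
  rw [PiLp.norm_eq_of_L2]; rfl

lemma pn_add (E F : Fin 2 → Matrix ι κ 𝕂) : pn (E + F) ≤ pn E + pn F := by
  simp only [pn_eq, WithLp.toLp_add]
  exact norm_add_le _ _

lemma pn_neg (E : Fin 2 → Matrix ι κ 𝕂) : pn (-E) = pn E := by
  simp [pn]

lemma pn_sub (E F : Fin 2 → Matrix ι κ 𝕂) : pn (E - F) ≤ pn E + pn F := by
  rw [sub_eq_add_neg, ← pn_neg F]; exact pn_add _ _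

lemma pn_zero (E : Fin 2 → Matrix ι κ 𝕂) (h : pn E ≤ 0) : E = 0 := by
  have h1 : pn E = 0 := le_antisymm h (pn_nonneg E)
  rw [pn_eq, norm_eq_zero] at h1
  exact (WithLp.toLp_eq_zero 2).1 h1

lemma pn_lmul (A : Matrix ι κ 𝕂) (E : Fin 2 → Matrix κ l 𝕂) :
    pn (fun k => A * E k) ≤ ‖A‖ * pn E := by
  unfold pn
  rw [← Real.sqrt_sq (norm_nonneg A), ← Real.sqrt_mul (sq_nonneg _), Finset.mul_sum]
  refine Real.sqrt_le_sqrt (Finset.sum_le_sum fun k _ => ?_)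
  rw [← mul_pow]
  exact pow_le_pow_left₀ (norm_nonneg _) (Matrix.frobenius_norm_mul _ _) 2

lemma pn_rmul (B : Matrix κ l 𝕂) (E : Fin 2 → Matrix ι κ 𝕂) :
    pn (fun k => E k * B) ≤ pn E * ‖B‖ := by
  unfold pn
  rw [← Real.sqrt_sq (norm_nonneg B), ← Real.sqrt_mul (Finset.sum_nonneg fun _ _ => sq_nonneg _),
    Finset.sum_mul]
  refine Real.sqrt_le_sqrt (Finset.sum_le_sum fun k _ => ?_)
  rw [← mul_pow]
  exact pow_le_pow_left₀ (norm_nonneg _) (Matrix.frobenius_norm_mul _ _) 2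

lemma pn_transpose (E : Fin 2 → Matrix ι κ 𝕂) : pn (fun k => (E k)ᵀ) = pn E := by
  simp [pn, Matrix.frobenius_norm_transpose]

lemma isUnit_one_add [DecidableEq ι] (B : Matrix ι ι 𝕂) (h : ‖B‖ < 1) : IsUnit (1 + B).det := by
  rw [← Matrix.isUnit_iff_isUnit_det]
  haveI : CompleteSpace (Matrix ι ι 𝕂) := FiniteDimensional.complete 𝕂 _
  have := isUnit_one_sub_of_norm_lt_one (x := -B) (by rwa [norm_neg])
  rwa [sub_neg_eq_add] at this

end basic

lemma stageS (p n : ℕ) (κ : ℝ) (hκ : κ = Real.sqrt 2 * ((p : ℝ) + 1))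
    (E : Fin 2 → Matrix (Fin p × Fin n) (Fin (p + 1) × Fin n) 𝕂) (hE : κ * pn E < 1) :
    ∃ (A : Matrix (Fin p × Fin n) (Fin p × Fin n) 𝕂)
      (B : Matrix (Fin (p + 1) × Fin n) (Fin (p + 1) × Fin n) 𝕂),
      (∀ k, (1 + A) * (Lc 𝕂 p n k + E k) = Lc 𝕂 p n k * (1 + B)) ∧
      ‖A‖ ≤ κ * pn E / (1 - κ * pn E) ∧ ‖B‖ ≤ κ * pn E / (1 - κ * pn E) := by
  obtain ⟨RA, RB, hR, hA, hB⟩ := exists_S (𝕂 := 𝕂) p n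
  rw [← hκ] at hA hB
  have hκ0 : 0 ≤ κ := by rw [hκ]; positivity
  let T : (Fin 2 → Matrix (Fin p × Fin n) (Fin (p + 1) × Fin n) 𝕂) →ₗ[𝕂]
      (Fin 2 → Matrix (Fin p × Fin n) (Fin (p + 1) × Fin n) 𝕂) :=
    { toFun := fun z => z + fun k => RA z * E k
      map_add' := by
        intro x y
        funext k
        simp only [map_add, Pi.add_apply, Matrix.add_mul]
        abel
      map_smul' := by
        intro c x
        funext k
        simp [Matrix.smul_mul] }
  have hT : ∀ z, T z = z + fun k => RA z * E k := fun _ => rfl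
  have bound : ∀ z, pn (fun k => RA z * E k) ≤ κ * pn E * pn z := by
    intro z
    refine (pn_lmul _ _).trans ?_
    have := mul_le_mul_of_nonneg_right (hA z) (pn_nonneg E)
    linarith
  have hinj : Function.Injective T := by
    rw [injective_iff_map_eq_zero]
    intro z hz
    rw [hT] at hz
    have h1 : z = - fun k => RA z * E k := eq_neg_of_add_eq_zero_left hz
    have h2 : pn z ≤ κ * pn E * pn z := by
      conv_lhs => rw [h1]
      rw [pn_neg]; exact bound z
    apply pn_zero
    nlinarith [pn_nonneg z]
  obtain ⟨z, hz⟩ := LinearMap.injective_iff_surjective.1 hinj (-E)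
  rw [hT] at hz
  have hzn : pn z ≤ pn E / (1 - κ * pn E) := by
    have h1 : z = -E - fun k => RA z * E k := eq_sub_of_add_eq hz
    have h2 : pn z ≤ pn E + κ * pn E * pn z := by
      conv_lhs => rw [h1]
      refine (pn_sub _ _).trans ?_
      rw [pn_neg]
      linarith [bound z]
    rw [le_div_iff₀ (by linarith)]
    linarith
  refine ⟨RA z, RB z, ?_, ?_, ?_⟩
  · intro k
    have h1 := hR z k
    have h2 := congrFun hz k
    simp only [Pi.add_apply, Pi.neg_apply] at h2
    rw [← h1] at h2
    rw [Matrix.add_mul, Matrix.one_mul, Matrix.mul_add, Matrix.mul_add, Matrix.mul_one]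
    rw [← sub_eq_zero] at h2 ⊢
    refine Eq.trans ?_ h2
    abel
  · refine (hA z).trans ?_
    rw [mul_div_assoc]
    exact mul_le_mul_of_nonneg_left hzn hκ0
  · refine (hB z).trans ?_
    rw [mul_div_assoc]
    exact mul_le_mul_of_nonneg_left hzn hκ0

lemma core_num (κS κT δ ρ t x q : ℝ) (hκS0 : 0 < κS) (hκT0 : 0 < κT) (hδ : 0 ≤ δ) (hρ : 0 ≤ ρ)
    (ht : 0 ≤ t) (hx0 : 0 ≤ x) (hq0 : 0 ≤ q)
    (h1 : κS * δ ≤ 1 / 20) (h2 : κT * δ ≤ 1 / 40) (h3 : κS * κT * δ * ρ ≤ 1 / 10)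
    (hz : x ≤ t * δ + (κT * q * ρ + κS * x * δ)) (hw : q ≤ t * δ + (κT * q * δ + κS * x * δ)) :
    κS * x ≤ t * (1.06 * (κS * δ) + 1.3 * (κS * κT * δ * ρ)) ∧ q ≤ t * (1.25 * δ) := by
  obtain ⟨X, hX⟩ : ∃ X, X = κS * x := ⟨_, rfl⟩
  rw [← hX] at hz hw ⊢
  have hX0 : 0 ≤ X := by rw [hX]; positivity
  have q1 : 0.975 * q ≤ δ * (t + X) := by
    have : κT * δ * q ≤ 1 / 40 * q := mul_le_mul_of_nonneg_right h2 hq0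
    linarith
  have x1 : 0.95 * X ≤ t * (κS * δ) + κS * κT * ρ * q := by
    have e1 : X ≤ κS * (t * δ + (κT * q * ρ + X * δ)) := by
      conv_lhs => rw [hX]
      exact mul_le_mul_of_nonneg_left hz hκS0.le
    have e2 : κS * δ * X ≤ 1 / 20 * X := mul_le_mul_of_nonneg_right h1 hX0
    linarith
  have x2 : κS * κT * ρ * (0.975 * q) ≤ κS * κT * ρ * (δ * (t + X)) :=
    mul_le_mul_of_nonneg_left q1 (by positivity)
  have x3 : κS * κT * δ * ρ * (t + X) ≤ 1 / 10 * (t + X) :=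
    mul_le_mul_of_nonneg_right h3 (by positivity)
  have x4 : t * (κS * δ) ≤ t * (1 / 20) := mul_le_mul_of_nonneg_left h1 ht
  have X1 : X ≤ 0.1802 * t := by linarith
  have X2 : δ * X ≤ δ * (0.1802 * t) := mul_le_mul_of_nonneg_left X1 hδ
  have q2 : q ≤ 1.2105 * (t * δ) := by
    have : 0 ≤ t * δ := by positivity
    linarith
  have p0 : 0 ≤ t * δ := by positivity
  refine ⟨?_, by linarith⟩
  have x5 : κS * κT * ρ * q ≤ κS * κT * ρ * (1.2105 * (t * δ)) :=
    mul_le_mul_of_nonneg_left q2 (by positivity)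
  have p1 : 0 ≤ t * (κS * δ) := by positivity
  have p2 : 0 ≤ t * (κS * κT * δ * ρ) := by positivity
  linarith

lemma stage1 (ε η n m : ℕ) (hε : 1 ≤ ε) (κS κT δ ρ : ℝ)
    (hκS : Real.sqrt 2 * ((ε : ℝ) + 1) ≤ κS)
    (hκT : ((ε + η + 1 : ℕ) : ℝ) / Real.sqrt 2 ≤ κT)
    (h1 : κS * δ ≤ 1 / 20) (h2 : κT * δ ≤ 1 / 40) (h3 : κS * κT * δ * ρ ≤ 1 / 10)
    (hδ : 0 ≤ δ) (hρ : 0 ≤ ρ)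
    (P : Fin 2 → Matrix (Fin (η + 1) × Fin m) (Fin (ε + 1) × Fin n) 𝕂)
    (D12 : Fin 2 → Matrix (Fin (η + 1) × Fin m) (Fin η × Fin m) 𝕂)
    (D21 : Fin 2 → Matrix (Fin ε × Fin n) (Fin (ε + 1) × Fin n) 𝕂)
    (D22 : Fin 2 → Matrix (Fin ε × Fin n) (Fin η × Fin m) 𝕂)
    (hP : pn P ≤ ρ) (h12 : pn D12 ≤ δ) (h21 : pn D21 ≤ δ) (h22 : pn D22 ≤ δ) :
    ∃ (A21 : Matrix (Fin ε × Fin n) (Fin (η + 1) × Fin m) 𝕂)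
      (A22 : Matrix (Fin ε × Fin n) (Fin ε × Fin n) 𝕂)
      (B11 : Matrix (Fin (ε + 1) × Fin n) (Fin (ε + 1) × Fin n) 𝕂)
      (B12 : Matrix (Fin (ε + 1) × Fin n) (Fin η × Fin m) 𝕂),
      (∀ k, A21 * P k + (1 + A22) * (Lc 𝕂 ε n k + D21 k) = Lc 𝕂 ε n k * (1 + B11)) ∧
      (∀ k, A21 * ((Lc 𝕂 η m k)ᵀ + D12 k) + (1 + A22) * D22 k = Lc 𝕂 ε n k * B12) ∧
      ‖A22‖ < 1 ∧ ‖B11‖ ≤ 1.06 * (κS * δ) + 1.3 * (κS * κT * δ * ρ) ∧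
      ‖B12‖ ≤ 1.25 * (κT * δ) := by
  obtain ⟨RA, RB, hR, hA, hB⟩ := exists_S (𝕂 := 𝕂) ε n
  obtain ⟨RC, RD, hR', hC, hD⟩ := exists_T (𝕂 := 𝕂) ε η n m hε
  have hκS0 : 0 < κS := lt_of_lt_of_le (by positivity) hκS
  have hκT0 : 0 < κT := lt_of_lt_of_le (by positivity) hκT
  have hA : ∀ z, ‖RA z‖ ≤ κS * pn z := fun z =>
    (hA z).trans (mul_le_mul_of_nonneg_right hκS (pn_nonneg z))
  have hB : ∀ z, ‖RB z‖ ≤ κS * pn z := fun z =>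
    (hB z).trans (mul_le_mul_of_nonneg_right hκS (pn_nonneg z))
  have hC : ∀ z, ‖RC z‖ ≤ κT * pn z := fun z =>
    (hC z).trans (mul_le_mul_of_nonneg_right hκT (pn_nonneg z))
  have hD : ∀ z, ‖RD z‖ ≤ κT * pn z := fun z =>
    (hD z).trans (mul_le_mul_of_nonneg_right hκT (pn_nonneg z))
  let f1 : (Fin 2 → Matrix (Fin ε × Fin n) (Fin (ε + 1) × Fin n) 𝕂) → (Fin 2 → Matrix (Fin ε × Fin n) (Fin η × Fin m) 𝕂) → (Fin 2 → Matrix (Fin ε × Fin n) (Fin (ε + 1) × Fin n) 𝕂) := fun z w k => RC w * P k + RA z * D21 k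
  let f2 : (Fin 2 → Matrix (Fin ε × Fin n) (Fin (ε + 1) × Fin n) 𝕂) → (Fin 2 → Matrix (Fin ε × Fin n) (Fin η × Fin m) 𝕂) → (Fin 2 → Matrix (Fin ε × Fin n) (Fin η × Fin m) 𝕂) := fun z w k => RC w * D12 k + RA z * D22 k
  let T : ((Fin 2 → Matrix (Fin ε × Fin n) (Fin (ε + 1) × Fin n) 𝕂) × (Fin 2 → Matrix (Fin ε × Fin n) (Fin η × Fin m) 𝕂)) →ₗ[𝕂] ((Fin 2 → Matrix (Fin ε × Fin n) (Fin (ε + 1) × Fin n) 𝕂) × (Fin 2 → Matrix (Fin ε × Fin n) (Fin η × Fin m) 𝕂)) :=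
    { toFun := fun z => (z.1 + f1 z.1 z.2, z.2 + f2 z.1 z.2)
      map_add' := by
        intro x y
        ext1
        · funext k
          simp only [f1, Prod.fst_add, Prod.snd_add, map_add, Pi.add_apply, Matrix.add_mul]
          abel
        · funext k
          simp only [f2, Prod.fst_add, Prod.snd_add, map_add, Pi.add_apply, Matrix.add_mul]
          abel
      map_smul' := by
        intro c x
        ext1
        · funext k
          simp [f1, Matrix.smul_mul]
        · funext k
          simp [f2, Matrix.smul_mul] }
  have hT : ∀ z, T z = (z.1 + f1 z.1 z.2, z.2 + f2 z.1 z.2) := fun _ => rfl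
  have b1 : ∀ z w, pn (f1 z w) ≤ κT * pn w * ρ + κS * pn z * δ := by
    intro z w
    refine (pn_add (fun k => RC w * P k) (fun k => RA z * D21 k)).trans ?_
    refine add_le_add ((pn_lmul _ _).trans ?_) ((pn_lmul _ _).trans ?_)
    · exact mul_le_mul (hC w) hP (pn_nonneg _) (mul_nonneg hκT0.le (pn_nonneg _))
    · exact mul_le_mul (hA z) h21 (pn_nonneg _) (mul_nonneg hκS0.le (pn_nonneg _))
  have b2 : ∀ z w, pn (f2 z w) ≤ κT * pn w * δ + κS * pn z * δ := by
    intro z w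
    refine (pn_add (fun k => RC w * D12 k) (fun k => RA z * D22 k)).trans ?_
    refine add_le_add ((pn_lmul _ _).trans ?_) ((pn_lmul _ _).trans ?_)
    · exact mul_le_mul (hC w) h12 (pn_nonneg _) (mul_nonneg hκT0.le (pn_nonneg _))
    · exact mul_le_mul (hA z) h22 (pn_nonneg _) (mul_nonneg hκS0.le (pn_nonneg _))
  -- numeric core: a defect t ∈ {0,1}
  have core : ∀ (t : ℝ), 0 ≤ t → ∀ z w, pn z ≤ t * δ + pn (f1 z w) → pn w ≤ t * δ + pn (f2 z w) →
      κS * pn z ≤ t * (1.06 * (κS * δ) + 1.3 * (κS * κT * δ * ρ)) ∧ pn w ≤ t * (1.25 * δ) := by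
    intro t ht z w hz hw
    exact core_num κS κT δ ρ t (pn z) (pn w) hκS0 hκT0 hδ hρ ht (pn_nonneg z) (pn_nonneg w) h1 h2 h3
      (by linarith [b1 z w]) (by linarith [b2 z w])
  have hinj : Function.Injective T := by
    rw [injective_iff_map_eq_zero]
    rintro ⟨z, w⟩ hz
    rw [hT] at hz
    simp only [Prod.mk_eq_zero] at hz
    have e1 : z = - f1 z w := eq_neg_of_add_eq_zero_left hz.1
    have e2 : w = - f2 z w := eq_neg_of_add_eq_zero_left hz.2
    have g1 : pn z ≤ 0 * δ + pn (f1 z w) := by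
      conv_lhs => rw [e1]
      rw [pn_neg]; linarith
    have g2 : pn w ≤ 0 * δ + pn (f2 z w) := by
      conv_lhs => rw [e2]
      rw [pn_neg]; linarith
    have := core 0 le_rfl z w g1 g2
    simp only [zero_mul] at this
    have hz0 : z = 0 := pn_zero z (by nlinarith [this.1])
    have hw0 : w = 0 := pn_zero w this.2
    rw [hz0, hw0]; rfl
  obtain ⟨⟨z, w⟩, hz⟩ := LinearMap.injective_iff_surjective.1 hinj (-D21, -D22)
  rw [hT] at hz
  simp only [Prod.mk.injEq] at hz
  obtain ⟨hz, hw⟩ := hz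
  have e1 : z = -D21 - f1 z w := eq_sub_of_add_eq hz
  have e2 : w = -D22 - f2 z w := eq_sub_of_add_eq hw
  have g1 : pn z ≤ 1 * δ + pn (f1 z w) := by
    conv_lhs => rw [e1]
    refine (pn_sub _ _).trans ?_
    rw [pn_neg]; linarith
  have g2 : pn w ≤ 1 * δ + pn (f2 z w) := by
    conv_lhs => rw [e2]
    refine (pn_sub _ _).trans ?_
    rw [pn_neg]; linarith
  obtain ⟨c1, c2⟩ := core 1 zero_le_one z w g1 g2
  simp only [one_mul] at c1 c2
  refine ⟨RC w, RA z, RB z, RD w, ?_, ?_, ?_, ?_, ?_⟩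
  · intro k
    have h1 := hR z k
    have h2 := congrFun hz k
    simp only [f1, Pi.add_apply, Pi.neg_apply] at h2
    rw [← h1] at h2
    rw [Matrix.add_mul, Matrix.one_mul, Matrix.mul_add, Matrix.mul_add, Matrix.mul_one]
    rw [← sub_eq_zero] at h2 ⊢
    refine Eq.trans ?_ h2
    abel
  · intro k
    have h1 := hR' w k
    have h2 := congrFun hw k
    simp only [f2, Pi.add_apply, Pi.neg_apply] at h2
    rw [← h1] at h2
    rw [Matrix.add_mul, Matrix.one_mul, Matrix.mul_add]
    rw [← sub_eq_zero] at h2 ⊢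
    refine Eq.trans ?_ h2
    abel
  · exact lt_of_le_of_lt ((hA z).trans c1) (by linarith)
  · exact (hB z).trans c1
  · refine (hD w).trans ?_
    have := mul_le_mul_of_nonneg_left c2 hκT0.le
    linarith

end PT
end BK17

namespace BK17
open scoped Matrix.Norms.Frobenius

lemma nu_num (d δ μ a b α β ν : ℝ) (hd : 3 ≤ d) (hδ : 0 ≤ δ) (hμ : 0 ≤ μ)
    (hs : d ^ 2 * δ * (1 + μ) ≤ 1 / 10)
    (ha : a = Real.sqrt 2 * d * δ) (hb : b = d ^ 2 * δ * (μ + δ))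
    (hα0 : 0 ≤ α) (hβ0 : 0 ≤ β) (hν0 : 0 ≤ ν)
    (hβ : β ≤ 1.06 * a + 1.3 * b) (hα : α ≤ 1.26 * a + 1.94 * b)
    (ha1 : a ≤ 1 / 20) (hb1 : b ≤ 1 / 10)
    (hν : ν ≤ δ + (α + β + α * β) * (μ + ν)) :
    ν ≤ 7 * d ^ 2 * δ * (1 + μ + μ ^ 2) := by
  have ha0 : 0 ≤ a := by rw [ha]; positivity
  have hb0 : 0 ≤ b := by rw [hb]; positivity
  obtain ⟨τ, hτ⟩ : ∃ τ, τ = 2.6 * a + 3.58 * b := ⟨_, rfl⟩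
  have h1 : α + β + α * β ≤ τ := by
    have : α * β ≤ 0.257 * β := mul_le_mul_of_nonneg_right (by linarith) hβ0
    rw [hτ]; linarith
  have hτ1 : τ ≤ 0.489 := by rw [hτ]; linarith
  have hτ0 : 0 ≤ τ := by rw [hτ]; positivity
  have h2 : ν ≤ δ + τ * (μ + ν) :=
    hν.trans (add_le_add le_rfl (mul_le_mul_of_nonneg_right h1 (by positivity)))
  have h3 : τ * ν ≤ 0.489 * ν := mul_le_mul_of_nonneg_right hτ1 hν0
  have h4 : ν ≤ 1.97 * (δ + τ * μ) := by
    have : 0 ≤ τ * μ := by positivity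
    linarith
  obtain ⟨D, hD⟩ : ∃ D, D = d ^ 2 * δ := ⟨_, rfl⟩
  have hD0 : 0 ≤ D := by rw [hD]; positivity
  have hδD : 9 * δ ≤ D := by
    rw [hD]
    exact mul_le_mul_of_nonneg_right (by nlinarith) hδ
  have hs2 : Real.sqrt 2 ≤ 1.4143 := by
    rw [Real.sqrt_le_left (by norm_num)]; norm_num
  have haD : a ≤ 0.4715 * D := by
    rw [ha, hD]
    have e1 : Real.sqrt 2 * (d * δ) ≤ 1.4143 * (d * δ) :=
      mul_le_mul_of_nonneg_right hs2 (by positivity)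
    have e2 : 3 * (d * δ) ≤ d * (d * δ) := mul_le_mul_of_nonneg_right hd (by positivity)
    nlinarith
  have hD1 : D ≤ 1 / 10 := by
    rw [← hD] at hs; nlinarith
  have hbD : b ≤ D * (μ + 0.0112) := by
    rw [hb, ← hD]
    exact mul_le_mul_of_nonneg_left (by linarith) hD0
  have h5 : τ ≤ D * (1.27 + 3.58 * μ) := by rw [hτ]; linarith
  have h6 : τ * μ ≤ D * (1.27 + 3.58 * μ) * μ := mul_le_mul_of_nonneg_right h5 hμ
  have h7 : (7 : ℝ) * d ^ 2 * δ * (1 + μ + μ ^ 2) = 7 * D * (1 + μ + μ ^ 2) := by rw [hD]; ring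
  rw [h7]
  have p1 : 0 ≤ D * μ := by positivity
  have p2 : 0 ≤ D * μ ^ 2 := by positivity
  nlinarith

set_option maxHeartbeats 2000000 in
lemma pencil_main {𝕂 : Type*} [RCLike 𝕂] (ε η n m : ℕ) (hε : 1 ≤ ε) (hη : 1 ≤ η) (δ : ℝ)
    (M D11 : Fin 2 → Matrix (Fin (η + 1) × Fin m) (Fin (ε + 1) × Fin n) 𝕂)
    (D12 : Fin 2 → Matrix (Fin (η + 1) × Fin m) (Fin η × Fin m) 𝕂)
    (D21 : Fin 2 → Matrix (Fin ε × Fin n) (Fin (ε + 1) × Fin n) 𝕂)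
    (D22 : Fin 2 → Matrix (Fin ε × Fin n) (Fin η × Fin m) 𝕂)
    (h11 : pn D11 ≤ δ) (h12 : pn D12 ≤ δ) (h21 : pn D21 ≤ δ) (h22 : pn D22 ≤ δ)
    (hs : ((ε + η + 1 : ℕ) : ℝ) ^ 2 * δ * (1 + pn M) ≤ 1 / 10) :
    ∃ (X : Matrix ((Fin (η + 1) × Fin m) ⊕ (Fin ε × Fin n))
        ((Fin (η + 1) × Fin m) ⊕ (Fin ε × Fin n)) 𝕂)
      (Y : Matrix ((Fin (ε + 1) × Fin n) ⊕ (Fin η × Fin m))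
        ((Fin (ε + 1) × Fin n) ⊕ (Fin η × Fin m)) 𝕂)
      (M' : Fin 2 → Matrix (Fin (η + 1) × Fin m) (Fin (ε + 1) × Fin n) 𝕂),
      IsUnit X.det ∧ IsUnit Y.det ∧
      (∀ k, X * fromBlocks (M k + D11 k) ((Lc 𝕂 η m k)ᵀ + D12 k) (Lc 𝕂 ε n k + D21 k) (D22 k) * Y
        = fromBlocks (M' k) (Lc 𝕂 η m k)ᵀ (Lc 𝕂 ε n k) 0) ∧
      pn (M' - M) ≤ 7 * ((ε + η + 1 : ℕ) : ℝ) ^ 2 * δ * (1 + pn M + pn M ^ 2) := by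
  obtain ⟨d, hd⟩ : ∃ d : ℝ, d = ((ε + η + 1 : ℕ) : ℝ) := ⟨_, rfl⟩
  have hd3 : 3 ≤ d := by
    rw [hd]
    have : 3 ≤ ε + η + 1 := by omega
    exact_mod_cast this
  obtain ⟨μ, hμ⟩ : ∃ μ, μ = pn M := ⟨_, rfl⟩
  have hμ0 : 0 ≤ μ := hμ ▸ pn_nonneg M
  have hδ0 : 0 ≤ δ := (pn_nonneg _).trans h11
  rw [← hd, ← hμ] at hs
  rw [← hd, ← hμ]
  have hs2 : Real.sqrt 2 ≤ 1.4143 := by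
    rw [Real.sqrt_le_left (by norm_num)]; norm_num
  have hs20 : 0 < Real.sqrt 2 := by positivity
  have hss : Real.sqrt 2 * Real.sqrt 2 = 2 := Real.mul_self_sqrt (by norm_num)
  have hD0 : 0 ≤ d ^ 2 * δ := by positivity
  have hD1 : d ^ 2 * δ ≤ 1 / 10 := by
    have : 0 ≤ d ^ 2 * δ * μ := by positivity
    linarith
  have hdδ : 3 * (d * δ) ≤ 1 / 10 := by
    have : 3 * (d * δ) ≤ d * (d * δ) := mul_le_mul_of_nonneg_right hd3 (by positivity)
    linarith
  have hδ1 : δ ≤ 1 := by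
    have : 3 * δ ≤ d * δ := mul_le_mul_of_nonneg_right hd3 hδ0
    linarith
  obtain ⟨κS, hκS⟩ : ∃ κ, κ = Real.sqrt 2 * d := ⟨_, rfl⟩
  obtain ⟨κT, hκT⟩ : ∃ κ, κ = d / Real.sqrt 2 := ⟨_, rfl⟩
  have hST : κS * κT = d ^ 2 := by rw [hκS, hκT]; field_simp
  have hκS0 : 0 < κS := by rw [hκS]; positivity
  have hκT0 : 0 < κT := by rw [hκT]; positivity
  have hST2 : κS = 2 * κT := by
    rw [hκS, hκT]; field_simp; linarith
  have a1 : κS * δ ≤ 1 / 20 := by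
    rw [hκS]
    have : Real.sqrt 2 * (d * δ) ≤ 1.4143 * (d * δ) :=
      mul_le_mul_of_nonneg_right hs2 (by positivity)
    linarith
  have a2 : κT * δ ≤ 1 / 40 := by rw [hST2] at a1; linarith
  have a3 : κS * κT * δ * (μ + δ) ≤ 1 / 10 := by
    rw [hST]
    refine le_trans (mul_le_mul_of_nonneg_left ?_ hD0) hs
    linarith
  have hεd : Real.sqrt 2 * ((ε : ℝ) + 1) ≤ κS := by
    rw [hκS]
    refine mul_le_mul_of_nonneg_left ?_ hs20.le
    rw [hd]; push_cast
    linarith [(Nat.cast_nonneg η : (0 : ℝ) ≤ η)]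
  have hηd : Real.sqrt 2 * ((η : ℝ) + 1) ≤ κS := by
    rw [hκS]
    refine mul_le_mul_of_nonneg_left ?_ hs20.le
    rw [hd]; push_cast
    linarith [(Nat.cast_nonneg ε : (0 : ℝ) ≤ ε)]
  have hP : pn (M + D11) ≤ μ + δ := by
    refine (pn_add _ _).trans ?_
    rw [← hμ]; linarith
  obtain ⟨A21, A22, B11, B12, q1, q2, nA22, nB11, nB12⟩ :=
    stage1 ε η n m hε κS κT δ (μ + δ) hεd (by rw [hκT, hd]) a1 a2 a3 hδ0 (by positivity)
      (M + D11) D12 D21 D22 hP h12 h21 h22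
  have nB11' : ‖B11‖ ≤ 0.183 := by linarith
  have uB11 := isUnit_one_add B11 (by linarith)
  have uA22 := isUnit_one_add A22 nA22
  obtain ⟨W, hW⟩ : ∃ W, W = (1 + B11)⁻¹ * B12 := ⟨_, rfl⟩
  have hW1 : (1 + B11) * W = B12 := by rw [hW, Matrix.mul_nonsing_inv_cancel_left _ _ uB11]
  have nW : ‖W‖ ≤ 1.54 * (κT * δ) := by
    have e1 : W = B12 - B11 * W := by
      rw [← hW1, Matrix.add_mul, Matrix.one_mul]; abel
    have e2 : ‖W‖ ≤ ‖B12‖ + ‖B11‖ * ‖W‖ := by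
      conv_lhs => rw [e1]
      exact (norm_sub_le _ _).trans (add_le_add le_rfl (Matrix.frobenius_norm_mul _ _))
    have e3 : ‖B11‖ * ‖W‖ ≤ 0.183 * ‖W‖ := mul_le_mul_of_nonneg_right nB11' (norm_nonneg _)
    have : 0 ≤ κT * δ := by positivity
    linarith
  obtain ⟨E, hE⟩ : ∃ E : Fin 2 → Matrix (Fin (η + 1) × Fin m) (Fin η × Fin m) 𝕂,
    E = D12 - fun k => (M + D11) k * W := ⟨_, rfl⟩
  have nE : pn E ≤ δ + (μ + δ) * (1.54 * (κT * δ)) := by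
    rw [hE]
    refine (pn_sub _ _).trans (add_le_add h12 ((pn_rmul _ _).trans ?_))
    exact mul_le_mul hP nW (norm_nonneg _) (by positivity)
  have nE2 : Real.sqrt 2 * ((η : ℝ) + 1) * pn E ≤ κS * δ + 1.54 * (κS * κT * δ * (μ + δ)) := by
    have := mul_le_mul hηd nE (pn_nonneg _) hκS0.le
    linarith
  have nE3 : Real.sqrt 2 * ((η : ℝ) + 1) * pn E ≤ 0.204 := by linarith
  obtain ⟨A, B, s1, nA, nB⟩ := stageS (𝕂 := 𝕂) η m _ rfl (fun k => (E k)ᵀ)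
    (by rw [pn_transpose]; linarith)
  rw [pn_transpose] at nA nB
  obtain ⟨x, hx⟩ : ∃ x, x = Real.sqrt 2 * ((η : ℝ) + 1) * pn E := ⟨_, rfl⟩
  rw [← hx] at nA nB nE2 nE3
  have hx0 : 0 ≤ x := by rw [hx]; exact mul_nonneg (by positivity) (pn_nonneg _)
  have hx1 : x / (1 - x) ≤ 1.257 * x := by
    rw [div_le_iff₀ (by linarith)]
    have := mul_le_mul_of_nonneg_left nE3 hx0
    linarith
  have uA := isUnit_one_add Aᵀ (by
    rw [Matrix.frobenius_norm_transpose]; linarith)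
  have uB := isUnit_one_add Bᵀ (by
    rw [Matrix.frobenius_norm_transpose]; linarith)
  have s2 : ∀ k, ((Lc 𝕂 η m k)ᵀ + E k) * (1 + Aᵀ) = (1 + Bᵀ) * (Lc 𝕂 η m k)ᵀ := by
    intro k
    have := congrArg Matrix.transpose (s1 k)
    simpa [Matrix.transpose_mul] using this
  obtain ⟨M', hM'⟩ : ∃ M' : Fin 2 → Matrix (Fin (η + 1) × Fin m) (Fin (ε + 1) × Fin n) 𝕂,
    M' = fun k => (1 + Bᵀ)⁻¹ * (M k + D11 k) * (1 + B11)⁻¹ := ⟨_, rfl⟩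
  have hM1 : ∀ k, (1 + Bᵀ) * M' k * (1 + B11) = M k + D11 k := by
    intro k
    rw [hM']
    simp only
    rw [Matrix.mul_assoc, Matrix.mul_assoc, Matrix.mul_assoc, Matrix.nonsing_inv_mul _ uB11,
      Matrix.mul_one, Matrix.mul_nonsing_inv_cancel_left _ _ uB]
  refine ⟨fromBlocks (1 + Bᵀ)⁻¹ 0 A21 (1 + A22),
    fromBlocks (1 + B11)⁻¹ (-(W * (1 + Aᵀ))) 0 (1 + Aᵀ), M', ?_, ?_, ?_, ?_⟩
  · rw [Matrix.det_fromBlocks_zero₁₂]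
    exact (Matrix.isUnit_nonsing_inv_det _ uB).mul uA22
  · rw [Matrix.det_fromBlocks_zero₂₁]
    exact (Matrix.isUnit_nonsing_inv_det _ uB11).mul uA
  · intro k
    have q1k := q1 k
    simp only [Pi.add_apply] at q1k
    have hEk : E k = D12 k - (M k + D11 k) * W := by rw [hE]; rfl
    rw [Matrix.fromBlocks_multiply]
    simp only [Matrix.zero_mul, add_zero]
    rw [q1k, q2 k, Matrix.fromBlocks_multiply]
    simp only [Matrix.mul_zero, add_zero]
    congr 1
    · rw [hM']
    · have s3 : (Lc 𝕂 η m k)ᵀ = (1 + Bᵀ)⁻¹ * (((Lc 𝕂 η m k)ᵀ + E k) * (1 + Aᵀ)) := by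
        rw [s2 k, Matrix.nonsing_inv_mul_cancel_left _ _ uB]
      conv_rhs => rw [s3, hEk]
      obtain ⟨Z, hZ⟩ : ∃ Z, Z = 1 + Aᵀ := ⟨_, rfl⟩
      obtain ⟨Z', hZ'⟩ : ∃ Z, Z = (1 + Bᵀ)⁻¹ := ⟨_, rfl⟩
      rw [← hZ, ← hZ']
      simp only [Matrix.mul_add, Matrix.add_mul, Matrix.mul_sub, Matrix.sub_mul, Matrix.mul_neg,
        Matrix.mul_assoc]
      abel
    · rw [Matrix.mul_assoc, Matrix.mul_nonsing_inv _ uB11, Matrix.mul_one]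
    · rw [← hW1]
      simp only [Matrix.mul_neg, Matrix.mul_assoc]
      abel
  · have hα : ‖Bᵀ‖ ≤ 1.257 * x := by rw [Matrix.frobenius_norm_transpose]; linarith
    refine nu_num d δ μ (κS * δ) (κS * κT * δ * (μ + δ)) ‖Bᵀ‖ ‖B11‖ (pn (M' - M)) hd3 hδ0 hμ0 hs
      (by rw [hκS]) (by rw [hST]) (norm_nonneg _) (norm_nonneg _) (pn_nonneg _) nB11 ?_ a1 a3 ?_
    · have p1 : 0 ≤ κS * δ := by positivity
      have p2 : 0 ≤ κS * κT * δ * (μ + δ) := by positivity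
      linarith
    · have e1 : M' - M = D11 - ((fun k => Bᵀ * M' k) + (fun k => M' k * B11)
          + fun k => (Bᵀ * M' k) * B11) := by
        funext k
        have := hM1 k
        simp only [Pi.sub_apply, Pi.add_apply]
        have e : D11 k = (1 + Bᵀ) * M' k * (1 + B11) - M k := by rw [this]; abel
        rw [e]
        simp only [Matrix.mul_add, Matrix.add_mul, Matrix.one_mul, Matrix.mul_one]
        abel
      have e2 : pn M' ≤ μ + pn (M' - M) := by
        have := pn_add M (M' - M)
        rw [add_sub_cancel] at this
        rwa [hμ]
      have e3 := pn_lmul Bᵀ M'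
      have e4 := pn_rmul B11 M'
      have e5 := pn_rmul B11 (fun k => Bᵀ * M' k)
      have e6 : pn (M' - M) ≤ δ + (‖Bᵀ‖ * pn M' + pn M' * ‖B11‖ + ‖Bᵀ‖ * pn M' * ‖B11‖) := by
        conv_lhs => rw [e1]
        refine (pn_sub _ _).trans (add_le_add h11 ((pn_add _ _).trans (add_le_add
          ((pn_add _ _).trans (add_le_add e3 e4)) (e5.trans ?_))))
        exact mul_le_mul_of_nonneg_right e3 (norm_nonneg _)
      have e7 : (‖Bᵀ‖ + ‖B11‖ + ‖Bᵀ‖ * ‖B11‖) * pn M' ≤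
          (‖Bᵀ‖ + ‖B11‖ + ‖Bᵀ‖ * ‖B11‖) * (μ + pn (M' - M)) :=
        mul_le_mul_of_nonneg_left e2 (by positivity)
      linarith

end BK17

namespace BK17

lemma lin_of {F : Type*} [Field F] {R C S ι κ : Type*}
    [Fintype R] [Fintype C] [DecidableEq R] [DecidableEq C] [Fintype S] [DecidableEq S]
    [Fintype ι] [DecidableEq ι] [Fintype κ] [DecidableEq κ]
    (L : Matrix R C (Polynomial F)) (P : Matrix ι κ (Polynomial F))
    (er : R ≃ S ⊕ ι) (ec : C ≃ S ⊕ κ)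
    (U : Matrix (S ⊕ ι) R (Polynomial F)) (Ui : Matrix R (S ⊕ ι) (Polynomial F))
    (V : Matrix C (S ⊕ κ) (Polynomial F)) (Vi : Matrix (S ⊕ κ) C (Polynomial F))
    (hU : U * Ui = 1) (hV : Vi * V = 1)
    (h : U * L * V = fromBlocks 1 0 0 P) : IsLinearization L P := by
  let es := Fintype.equivFin S
  refine ⟨Fintype.card S, er.trans (Equiv.sumCongr es (Equiv.refl ι)),
    ec.trans (Equiv.sumCongr es (Equiv.refl κ)), U.submatrix er id, V.submatrix id ec, ?_, ?_, ?_⟩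
  · have : U.submatrix er id * Ui.submatrix id er = 1 := by
      have := Matrix.submatrix_mul U Ui er id er Function.bijective_id
      rw [← this, hU]; simp
    exact (Matrix.isUnit_iff_isUnit_det _).1 (IsUnit.of_mul_eq_one _ this)
  · have : Vi.submatrix ec id * V.submatrix id ec = 1 := by
      have := Matrix.submatrix_mul Vi V ec id ec Function.bijective_id
      rw [← this, hV]; simp
    exact (Matrix.isUnit_iff_isUnit_det _).1 (IsUnit.of_mul_eq_one_right _ this)
  · have h1 : U.submatrix er id * L * V.submatrix id ec = (U * L * V).submatrix er ec := by
      rw [Matrix.submatrix_mul (U * L) V er id ec Function.bijective_id,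
        Matrix.submatrix_mul U L er id id Function.bijective_id]; simp
    rw [h1, h, Matrix.submatrix_submatrix]
    ext i j
    rcases i with i | i <;> rcases j with j | j <;>
      simp [Matrix.one_apply]

lemma lin_transfer {F : Type*} [Field F] {R C ι κ : Type*}
    [Fintype R] [Fintype C] [DecidableEq R] [DecidableEq C]
    (L L' : Matrix R C (Polynomial F)) (P : Matrix ι κ (Polynomial F))
    (X : Matrix R R (Polynomial F)) (Y : Matrix C C (Polynomial F))
    (hX : IsUnit X.det) (hY : IsUnit Y.det) (h : X * L * Y = L')
    (hL : IsLinearization L' P) : IsLinearization L P := by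
  obtain ⟨s, er, ec, U, V, hU, hV, hh⟩ := hL
  refine ⟨s, er, ec, U * X, Y * V, ?_, ?_, ?_⟩
  · rw [Matrix.det_mul]; exact hU.mul hX
  · rw [Matrix.det_mul]; exact hY.mul hV
  · rw [← hh, ← h]
    simp only [Matrix.mul_assoc]

lemma lin_blocks {F : Type*} [Field F] {R1 C1 S1 S2 ι κ : Type*}
    [Fintype R1] [Fintype C1] [DecidableEq R1] [DecidableEq C1]
    [Fintype S1] [DecidableEq S1] [Fintype S2] [DecidableEq S2]
    [Fintype ι] [DecidableEq ι] [Fintype κ] [DecidableEq κ]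
    (M : Matrix R1 C1 (Polynomial F)) (B : Matrix R1 S2 (Polynomial F))
    (C : Matrix S1 C1 (Polynomial F)) (Cr : Matrix C1 S1 (Polynomial F))
    (Λ : Matrix C1 κ (Polynomial F)) (e : Matrix κ C1 (Polynomial F))
    (Bl : Matrix S2 R1 (Polynomial F)) (N : Matrix ι R1 (Polynomial F))
    (n' : Matrix R1 ι (Polynomial F))
    (er : R1 ⊕ S1 ≃ (S1 ⊕ S2) ⊕ ι) (ec : C1 ⊕ S2 ≃ (S1 ⊕ S2) ⊕ κ)
    (c1 : C * Cr = 1) (c2 : C * Λ = 0) (c3 : e * Λ = 1) (c4 : e * Cr = 0)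
    (b1 : Bl * B = 1) (b2 : N * B = 0) (b3 : N * n' = 1) (b4 : Bl * n' = 0) :
    IsLinearization (fromBlocks M B C 0) (N * M * Λ) := by
  refine lin_of _ _ er ec
    (fromBlocks (fromRows 0 Bl) (fromRows 1 (-(Bl * M * Cr))) N (-(N * M * Cr)))
    (fromBlocks (fromCols (M * Cr) B) n' (fromCols 1 0) 0)
    (fromBlocks (fromCols Cr 0) Λ (fromCols 0 1) (-(Bl * M * Λ)))
    (fromBlocks (fromRows C (Bl * M * Λ * e)) (fromRows 0 1) e 0) ?_ ?_ ?_
  · rw [Matrix.fromBlocks_multiply, ← Matrix.fromBlocks_one]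
    congr 1
    · simp only [Matrix.fromRows_mul, Matrix.mul_fromCols, b1, Matrix.mul_assoc, Matrix.one_mul,
        Matrix.zero_mul, Matrix.mul_zero, Matrix.neg_mul, Matrix.mul_one]
      ext (i | i) (j | j) <;> simp [Matrix.one_apply]
    · simp [Matrix.fromRows_mul, b4]
    · simp only [Matrix.mul_fromCols, b2, Matrix.mul_assoc, Matrix.neg_mul, Matrix.mul_one,
        Matrix.mul_zero]
      ext i (j | j) <;> simp
    · simp [b3]
  · rw [Matrix.fromBlocks_multiply, ← Matrix.fromBlocks_one]
    congr 1
    · simp only [Matrix.fromRows_mul, Matrix.mul_fromCols, c1, c4, Matrix.mul_assoc, Matrix.one_mul,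
        Matrix.zero_mul, Matrix.mul_zero, Matrix.neg_mul, Matrix.mul_one]
      ext (i | i) (j | j) <;> simp [Matrix.one_apply]
    · simp only [Matrix.fromRows_mul, c2, c3, Matrix.mul_assoc, Matrix.one_mul,
        Matrix.zero_mul, Matrix.mul_zero, Matrix.neg_mul, Matrix.mul_one]
      ext (i | i) j <;> simp
    · simp [Matrix.mul_fromCols, c4]
    · simp [c3]
  · rw [Matrix.fromBlocks_multiply, Matrix.fromBlocks_multiply]
    congr 1
    · simp only [Matrix.fromRows_mul, Matrix.mul_fromCols, Matrix.mul_assoc, Matrix.one_mul,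
        Matrix.zero_mul, Matrix.mul_zero, Matrix.neg_mul, Matrix.mul_one, b1, Matrix.add_mul, c1]
      ext (i | i) (j | j) <;> simp [Matrix.one_apply]
    · simp only [Matrix.fromRows_mul, Matrix.mul_assoc, Matrix.one_mul,
        Matrix.zero_mul, Matrix.mul_zero, Matrix.neg_mul, Matrix.mul_one, b1, Matrix.add_mul, c2]
      ext (i | i) j <;> simp
    · simp only [Matrix.mul_fromCols, Matrix.mul_assoc, b2, c1, Matrix.mul_sub, Matrix.add_mul,
        Matrix.neg_mul, Matrix.mul_one, Matrix.mul_zero, Matrix.one_mul]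
      ext i (j | j) <;> simp
    · simp [b2, Matrix.mul_assoc, Matrix.add_mul, c2]

noncomputable def Lr (F : Type*) [Field F] (k : ℕ) : Matrix (Fin (k + 1)) (Fin k) (Polynomial F) :=
  Matrix.of fun i j => if (i : ℕ) ≤ (j : ℕ) then -Polynomial.X ^ ((j : ℕ) - (i : ℕ)) else 0

noncomputable def el (F : Type*) [Field F] (k : ℕ) : Matrix (Fin 1) (Fin (k + 1)) (Polynomial F) :=
  Matrix.of fun _ j => if j = Fin.last k then 1 else 0

lemma Lk_eq (F : Type*) [Field F] (k : ℕ) (i : Fin k) (j : Fin (k + 1)) :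
    Lk F k i j = (if j = i.castSucc then -1 else 0) + (if j = i.succ then X else 0) := by
  simp only [Lk, Matrix.of_apply, Fin.ext_iff, Fin.val_castSucc, Fin.val_succ]
  split_ifs <;> first | omega | simp

lemma Lk_mul {F : Type*} [Field F] {κ : Type*} (k : ℕ) (A : Matrix (Fin (k + 1)) κ (Polynomial F))
    (i : Fin k) (j : κ) : (Lk F k * A) i j = - A i.castSucc j + X * A i.succ j := by
  simp [Matrix.mul_apply, Lk_eq, add_mul, Finset.sum_add_distrib]

lemma Lk_Lr (F : Type*) [Field F] (k : ℕ) : Lk F k * Lr F k = 1 := by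
  ext1 i j
  rw [Lk_mul]
  simp only [Lr, Matrix.of_apply, Fin.val_castSucc, Fin.val_succ, Matrix.one_apply, Fin.ext_iff]
  split_ifs
  · omega
  · rw [show (j : ℕ) - i = (j - (i + 1)) + 1 by omega, pow_succ]; ring
  · rename_i h3; simp [h3]
  · omega
  · omega
  · omega
  · omega
  · simp

lemma Lk_Lam (F : Type*) [Field F] (k : ℕ) : Lk F k * Lam F k = 0 := by
  ext1 i j
  rw [Lk_mul]
  simp only [Lam, Matrix.of_apply, Fin.val_castSucc, Fin.val_succ, Matrix.zero_apply]
  rw [show k - (i : ℕ) = (k - (i + 1)) + 1 by omega, pow_succ]; ring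

lemma el_Lam (F : Type*) [Field F] (k : ℕ) : el F k * Lam F k = 1 := by
  ext1 i j
  simp [el, Lam, Matrix.mul_apply, Matrix.one_apply, Subsingleton.elim i j]

lemma el_Lr (F : Type*) [Field F] (k : ℕ) : el F k * Lr F k = 0 := by
  ext1 i j
  simp only [el, Matrix.mul_apply, Matrix.of_apply, ite_mul, one_mul, zero_mul,
    Finset.sum_ite_eq', Finset.mem_univ, if_true, Finset.sum_ite_eq, Matrix.zero_apply]
  simp [Lr]

lemma lin_blockKron {F : Type*} [Field F] (ε n η m : ℕ)
    (M : Matrix (Fin (η + 1) × Fin m) (Fin (ε + 1) × Fin n) (Polynomial F)) :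
    IsLinearization (blockKron F ε n η m M) (QpolyOf F ε n η m M) := by
  unfold blockKron QpolyOf
  refine lin_blocks M _ _ (Lr F ε ⊗ₖ 1) _ (el F ε ⊗ₖ 1) ((Lr F η)ᵀ ⊗ₖ 1) _ ((el F η)ᵀ ⊗ₖ 1)
    (Fintype.equivOfCardEq ?_) (Fintype.equivOfCardEq ?_) ?_ ?_ ?_ ?_ ?_ ?_ ?_ ?_
  · simp; ring
  · simp; ring
  · rw [← Matrix.mul_kronecker_mul, Lk_Lr]; simp
  · rw [← Matrix.mul_kronecker_mul, Lk_Lam]; simp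
  · rw [← Matrix.mul_kronecker_mul, el_Lam]; simp
  · rw [← Matrix.mul_kronecker_mul, el_Lr]; simp
  · rw [← Matrix.mul_kronecker_mul, ← Matrix.transpose_mul, Lk_Lr]; simp
  · rw [← Matrix.mul_kronecker_mul, ← Matrix.transpose_mul, Lk_Lam]; simp
  · rw [← Matrix.mul_kronecker_mul, ← Matrix.transpose_mul, el_Lam]; simp
  · rw [← Matrix.mul_kronecker_mul, ← Matrix.transpose_mul, el_Lr]; simp

end BK17

namespace BK17

lemma lin_reindex {F : Type*} [Field F] {R C ι κ : Type*}
    [Fintype R] [Fintype C] [DecidableEq R] [DecidableEq C]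
    (L : Matrix R C (Polynomial F)) (P : Matrix ι κ (Polynomial F))
    (er : R ≃ R) (ec : C ≃ C) (hL : IsLinearization (L.submatrix er ec) P) :
    IsLinearization L P := by
  obtain ⟨s, er', ec', U, V, hU, hV, hh⟩ := hL
  refine ⟨s, er.symm.trans er', ec.symm.trans ec', U.submatrix er.symm er.symm,
    V.submatrix ec.symm ec.symm, ?_, ?_, ?_⟩
  · rwa [Matrix.det_submatrix_equiv_self]
  · rwa [Matrix.det_submatrix_equiv_self]
  · rw [← hh]
    have : U.submatrix er.symm er.symm * L * V.submatrix ec.symm ec.symm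
        = (U * L.submatrix er ec * V).submatrix er.symm ec.symm := by
      rw [Matrix.submatrix_mul (U * L.submatrix er ec) V er.symm ec.symm ec.symm ec.symm.bijective,
        Matrix.submatrix_mul U (L.submatrix er ec) er.symm er.symm ec.symm er.symm.bijective,
        Matrix.submatrix_submatrix]
      simp
    rw [this, Matrix.submatrix_submatrix]
    congr 1 <;> · funext i; simp

lemma Q_apply {F : Type*} [Field F] (ε n η m : ℕ)
    (M : Matrix (Fin (η + 1) × Fin m) (Fin (ε + 1) × Fin n) (Polynomial F))
    (x : Fin 1 × Fin m) (y : Fin 1 × Fin n) :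
    QpolyOf F ε n η m M x y = ∑ i : Fin (η + 1), ∑ j : Fin (ε + 1),
      X ^ ((η - (i : ℕ)) + (ε - (j : ℕ))) * M (i, x.2) (j, y.2) := by
  unfold QpolyOf
  simp only [Matrix.mul_apply, Fintype.sum_prod_type, Matrix.kroneckerMap_apply,
    Matrix.transpose_apply, Lam, Matrix.of_apply, Matrix.one_apply]
  simp only [mul_ite, ite_mul, mul_one, mul_zero, zero_mul, Finset.sum_ite_eq, Finset.sum_ite_eq',
    Finset.mem_univ, if_true]
  simp only [Finset.sum_mul]
  rw [Finset.sum_comm]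
  refine Finset.sum_congr rfl fun i _ => Finset.sum_congr rfl fun j _ => ?_
  rw [pow_add]; ring

noncomputable def flipM {F : Type*} [Field F] (ε n η m : ℕ)
    (M : Matrix (Fin (η + 1) × Fin m) (Fin (ε + 1) × Fin n) (Polynomial F)) :
    Matrix (Fin (η + 1) × Fin m) (Fin (ε + 1) × Fin n) (Polynomial F) :=
  Matrix.of fun x y => (M (Fin.rev x.1, x.2) (Fin.rev y.1, y.2)).reflect 1

lemma reflect_sum {F : Type*} [Field F] {ι : Type*} (s : Finset ι) (f : ι → Polynomial F) (d : ℕ) :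
    (∑ i ∈ s, f i).reflect d = ∑ i ∈ s, (f i).reflect d := by
  ext k
  simp [Polynomial.finsetSum_coeff]

lemma Q_flip {F : Type*} [Field F] (ε n η m : ℕ)
    (M : Matrix (Fin (η + 1) × Fin m) (Fin (ε + 1) × Fin n) (Polynomial F))
    (hM : ∀ i j, (M i j).natDegree ≤ 1) :
    QpolyOf F ε n η m (flipM ε n η m M) = revMat (ε + η + 1) (QpolyOf F ε n η m M) := by
  ext1 x y
  simp only [revMat, Matrix.of_apply]
  rw [Q_apply, Q_apply, reflect_sum, ← Equiv.sum_comp Fin.revPerm]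
  refine Finset.sum_congr rfl fun i _ => ?_
  rw [reflect_sum, ← Equiv.sum_comp Fin.revPerm]
  refine Finset.sum_congr rfl fun j _ => ?_
  have hi := i.2
  have hj := j.2
  rw [Polynomial.reflect_mul _ _ (F := ε + η) (by rw [natDegree_X_pow]; omega) (hM _ _),
    Polynomial.reflect_monomial, Polynomial.revAt_le (by omega)]
  simp only [flipM, Matrix.of_apply, Fin.revPerm_apply, Fin.rev_rev, Fin.val_rev]
  congr 2
  omega

lemma lin_rev {F : Type*} [Field F] (ε n η m : ℕ)
    (M : Matrix (Fin (η + 1) × Fin m) (Fin (ε + 1) × Fin n) (Polynomial F))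
    (hM : ∀ i j, (M i j).natDegree ≤ 1) :
    IsLinearization (revMat 1 (blockKron F ε n η m M))
      (revMat (ε + η + 1) (QpolyOf F ε n η m M)) := by
  rw [← Q_flip _ _ _ _ _ hM]
  refine lin_reindex _ _
    (Equiv.sumCongr (Equiv.prodCongr Fin.revPerm (Equiv.refl _))
      (Equiv.prodCongr Fin.revPerm (Equiv.refl _)))
    (Equiv.sumCongr (Equiv.prodCongr Fin.revPerm (Equiv.refl _))
      (Equiv.prodCongr Fin.revPerm (Equiv.refl _))) ?_
  refine lin_transfer _ _ _ (fromBlocks 1 0 0 (-1)) (fromBlocks 1 0 0 (-1)) ?_ ?_ ?_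
    (lin_blockKron ε n η m (flipM ε n η m M))
  · rw [Matrix.det_fromBlocks_zero₂₁, Matrix.det_one, one_mul, Matrix.det_neg, Matrix.det_one,
      mul_one]
    exact (isUnit_one.neg).pow _
  · rw [Matrix.det_fromBlocks_zero₂₁, Matrix.det_one, one_mul, Matrix.det_neg, Matrix.det_one,
      mul_one]
    exact (isUnit_one.neg).pow _
  · have h1 : Polynomial.reflect 1 (-1 : Polynomial F) = -X := by
      rw [← Polynomial.C_1, ← Polynomial.C_neg, Polynomial.reflect_C]; simp
    have hL : ∀ (k : ℕ) (i : Fin k) (j : Fin (k + 1)),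
        -(Polynomial.reflect 1 (Lk F k (Fin.rev i) (Fin.rev j))) = Lk F k i j := by
      intro k i j
      have hi := i.2
      have hj := j.2
      simp only [Lk, Matrix.of_apply, Fin.val_rev]
      split_ifs <;> first | omega | simp [h1]
    have e1 : (revMat 1 (blockKron F ε n η m M)).submatrix 
      (Equiv.sumCongr (Equiv.prodCongr Fin.revPerm (Equiv.refl _))
      (Equiv.prodCongr Fin.revPerm (Equiv.refl _)))
      (Equiv.sumCongr (Equiv.prodCongr Fin.revPerm (Equiv.refl _))
      (Equiv.prodCongr Fin.revPerm (Equiv.refl _))) = fromBlocks (flipM ε n η m M) 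
        (-((Lk F η).transpose ⊗ₖ (1 : Matrix (Fin m) (Fin m) (Polynomial F))))
        (-((Lk F ε) ⊗ₖ (1 : Matrix (Fin n) (Fin n) (Polynomial F)))) 0 := by
      ext1 (i | i) (j | j)
      · simp [revMat, blockKron, flipM]; rfl
      · simp only [revMat, blockKron, Matrix.submatrix_apply, Equiv.sumCongr_apply, Sum.map_inl, Sum.map_inr, Matrix.of_apply, Matrix.fromBlocks_apply₁₂, Matrix.kroneckerMap_apply, Matrix.transpose_apply, Equiv.prodCongr_apply, Prod.map_fst, Prod.map_snd, Matrix.neg_apply, Equiv.coe_refl, id, Fin.revPerm_apply, Matrix.one_apply]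
        rw [← hL η j.1 i.1]
        split_ifs <;> simp
      · simp only [revMat, blockKron, Matrix.submatrix_apply, Equiv.sumCongr_apply, Sum.map_inl, Sum.map_inr, Matrix.of_apply, Matrix.fromBlocks_apply₂₁, Matrix.kroneckerMap_apply, Matrix.transpose_apply, Equiv.prodCongr_apply, Prod.map_fst, Prod.map_snd, Matrix.neg_apply, Equiv.coe_refl, id, Fin.revPerm_apply, Matrix.one_apply]
        rw [← hL ε i.1 j.1]
        split_ifs <;> simp
      · simp [revMat, blockKron]
    rw [e1, Matrix.fromBlocks_multiply, Matrix.fromBlocks_multiply]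
    simp [blockKron]

end BK17

namespace BK17
open scoped Matrix.Norms.Frobenius

section PH
variable {𝕂 : Type*} [RCLike 𝕂]

def cf {ι κ : Type*} (k : ℕ) (P : Matrix ι κ (Polynomial 𝕂)) : Matrix ι κ 𝕂 :=
  Matrix.of fun i j => (P i j).coeff k

lemma cf_ext {ι κ : Type*} (P Q : Matrix ι κ (Polynomial 𝕂)) (h : ∀ k, cf k P = cf k Q) : P = Q := by
  ext i j k
  exact congrFun (congrFun (h k) i) j

lemma cf_lmul {ι κ l : Type*} [Fintype κ] (A : Matrix ι κ 𝕂) (P : Matrix κ l (Polynomial 𝕂)) (k : ℕ) :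
    cf k (A.map Polynomial.C * P) = A * cf k P := by
  ext i j
  simp [cf, Matrix.mul_apply, Polynomial.finsetSum_coeff]

lemma cf_rmul {ι κ l : Type*} [Fintype κ] (A : Matrix κ l 𝕂) (P : Matrix ι κ (Polynomial 𝕂)) (k : ℕ) :
    cf k (P * A.map Polynomial.C) = cf k P * A := by
  ext i j
  simp [cf, Matrix.mul_apply, Polynomial.finsetSum_coeff]

lemma cf_rev {ι κ : Type*} (P : Matrix ι κ (Polynomial 𝕂)) (k d : ℕ) :
    cf k (revMat d P) = cf (Polynomial.revAt d k) P := by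
  ext i j
  simp [cf, revMat]

lemma rev_mul {ι κ : Type*} [Fintype ι] [Fintype κ] (A : Matrix ι ι 𝕂) (B : Matrix κ κ 𝕂)
    (P : Matrix ι κ (Polynomial 𝕂)) (d : ℕ) :
    revMat d (A.map Polynomial.C * P * B.map Polynomial.C) =
      A.map Polynomial.C * revMat d P * B.map Polynomial.C := by
  apply cf_ext
  intro k
  simp only [cf_rev, cf_rmul, cf_lmul]

lemma det_map_C {ι : Type*} [Fintype ι] [DecidableEq ι] (A : Matrix ι ι 𝕂) (h : IsUnit A.det) :
    IsUnit (A.map (Polynomial.C : 𝕂 →+* Polynomial 𝕂)).det := by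
  have := RingHom.map_det (Polynomial.C : 𝕂 →+* Polynomial 𝕂) A
  rw [RingHom.mapMatrix_apply] at this
  rw [← this]
  exact h.map _

def pc {ι κ : Type*} (P : Matrix ι κ (Polynomial 𝕂)) : Fin 2 → Matrix ι κ 𝕂 := fun k => cf k P

lemma sum_support (p : Polynomial 𝕂) (N : ℕ) (h : p.natDegree < N) :
    ∑ k ∈ p.support, ‖p.coeff k‖ ^ 2 = ∑ k ∈ Finset.range N, ‖p.coeff k‖ ^ 2 := by
  refine Finset.sum_subset ?_ ?_
  · intro k hk
    rw [Finset.mem_range]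
    exact lt_of_le_of_lt (Polynomial.le_natDegree_of_mem_supp k hk) h
  · intro k _ hk
    rw [Polynomial.notMem_support_iff.1 hk]; simp

lemma polyFrob_pc {ι κ : Type*} [Fintype ι] [Fintype κ] (P : Matrix ι κ (Polynomial 𝕂))
    (h : ∀ i j, (P i j).natDegree ≤ 1) : polyFrob P = pn (pc P) := by
  unfold polyFrob pn
  congr 1
  simp only [fsq, Fin.sum_univ_two, ← Finset.sum_add_distrib]
  refine Finset.sum_congr rfl fun i _ => Finset.sum_congr rfl fun j _ => ?_
  rw [sum_support _ 2 (by have := h i j; omega), Finset.sum_range_succ, Finset.sum_range_one]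
  simp [pc, cf]

lemma pn_sub_le {ι κ ι' κ' : Type*} [Fintype ι] [Fintype κ] [Fintype ι'] [Fintype κ']
    (E : Fin 2 → Matrix ι κ 𝕂) (f : ι' → ι) (g : κ' → κ) (hf : Function.Injective f)
    (hg : Function.Injective g) : pn (fun k => (E k).submatrix f g) ≤ pn E := by
  unfold pn
  refine Real.sqrt_le_sqrt (Finset.sum_le_sum fun k _ => ?_)
  rw [fsq, fsq]
  classical
  calc ∑ i, ∑ j, ‖(E k).submatrix f g i j‖ ^ 2 ≤ ∑ i, ∑ j, ‖E k (f i) j‖ ^ 2 := by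
        refine Finset.sum_le_sum fun i _ => ?_
        have := Finset.sum_le_sum_of_subset_of_nonneg (f := fun j => ‖E k (f i) j‖ ^ 2)
          (Finset.subset_univ (Finset.univ.image g)) (fun _ _ _ => by positivity)
        rwa [Finset.sum_image (fun _ _ _ _ h => hg h)] at this
    _ ≤ _ := by
        have := Finset.sum_le_sum_of_subset_of_nonneg (f := fun i => ∑ j, ‖E k i j‖ ^ 2)
          (Finset.subset_univ (Finset.univ.image f)) (fun _ _ _ => by positivity)
        rwa [Finset.sum_image (fun _ _ _ _ h => hf h)] at this

noncomputable def toP {ι κ : Type*} (E : Fin 2 → Matrix ι κ 𝕂) : Matrix ι κ (Polynomial 𝕂) :=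
  Matrix.of fun i j => Polynomial.C (E 1 i j) * Polynomial.X + Polynomial.C (E 0 i j)

lemma toP_deg {ι κ : Type*} (E : Fin 2 → Matrix ι κ 𝕂) (i : ι) (j : κ) :
    (toP E i j).natDegree ≤ 1 := by
  simp only [toP, Matrix.of_apply]
  exact Polynomial.natDegree_linear_le

lemma cf_toP {ι κ : Type*} (E : Fin 2 → Matrix ι κ 𝕂) (k : Fin 2) : cf k (toP E) = E k := by
  ext i j
  fin_cases k <;> simp [cf, toP]

lemma cf_deg {ι κ : Type*} (P : Matrix ι κ (Polynomial 𝕂)) (h : ∀ i j, (P i j).natDegree ≤ 1)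
    (k : ℕ) (hk : 2 ≤ k) : cf k P = 0 := by
  ext i j
  exact Polynomial.coeff_eq_zero_of_natDegree_lt (by have := h i j; omega)

lemma cf_Lk (p n : ℕ) (k : Fin 2) :
    cf k (Lk 𝕂 p ⊗ₖ (1 : Matrix (Fin n) (Fin n) (Polynomial 𝕂))) = Lc 𝕂 p n k := by
  ext x y
  obtain ⟨x1, x2⟩ := x
  obtain ⟨y1, y2⟩ := y
  fin_cases k
  · simp only [cf, Matrix.of_apply, Matrix.kroneckerMap_apply, Lk_eq, Matrix.one_apply, Fin.zero_eta, Fin.val_zero, Lc0_apply, Prod.mk.injEq, @eq_comm _ y1, @eq_comm _ y2]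
    by_cases h1 : x1.castSucc = y1 <;> by_cases h2 : x2 = y2 <;> by_cases h3 : x1.succ = y1 <;>
      simp [h1, h2, h3]
  · simp only [cf, Matrix.of_apply, Matrix.kroneckerMap_apply, Lk_eq, Matrix.one_apply, Fin.mk_one, Fin.val_one, Lc1_apply, Prod.mk.injEq, @eq_comm _ y1, @eq_comm _ y2]
    by_cases h1 : x1.castSucc = y1 <;> by_cases h2 : x2 = y2 <;> by_cases h3 : x1.succ = y1 <;>
      simp [h1, h2, h3, Polynomial.coeff_one]

lemma cf_blockKron (ε n η m : ℕ)
    (M : Matrix (Fin (η + 1) × Fin m) (Fin (ε + 1) × Fin n) (Polynomial 𝕂)) (k : Fin 2) :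
    cf k (blockKron 𝕂 ε n η m M) =
      fromBlocks (cf k M) (Lc 𝕂 η m k)ᵀ (Lc 𝕂 ε n k) 0 := by
  rw [← cf_Lk, ← cf_Lk]
  ext (i | i) (j | j) <;> simp [cf, blockKron, Matrix.one_apply, eq_comm]

lemma blockKron_deg (ε n η m : ℕ)
    (M : Matrix (Fin (η + 1) × Fin m) (Fin (ε + 1) × Fin n) (Polynomial 𝕂))
    (hM : ∀ i j, (M i j).natDegree ≤ 1) (i j) : (blockKron 𝕂 ε n η m M i j).natDegree ≤ 1 := by
  have hL : ∀ k i j, (Lk 𝕂 k i j).natDegree ≤ 1 := by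
    intro k i j
    simp only [Lk, Matrix.of_apply]
    split_ifs <;> simp
  rcases i with i | i <;> rcases j with j | j
  · exact hM i j
  · simp only [blockKron, Matrix.fromBlocks_apply₁₂, Matrix.kroneckerMap_apply, Matrix.one_apply, Matrix.transpose_apply]
    split_ifs
    · rw [mul_one]; exact hL _ _ _
    · simp
  · simp only [blockKron, Matrix.fromBlocks_apply₂₁, Matrix.kroneckerMap_apply, Matrix.one_apply]
    split_ifs
    · rw [mul_one]; exact hL _ _ _
    · simp
  · simp [blockKron]

lemma one_hot {ι : Type*} [Fintype ι] (e : ι → ℕ) (he : Function.Injective e) (c : ι → 𝕂) (l : ℕ) :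
    ‖∑ j, (if l = e j then c j else 0)‖ ^ 2 = ∑ j, (if l = e j then ‖c j‖ ^ 2 else 0) := by
  classical
  by_cases h : ∃ j, l = e j
  · obtain ⟨j, rfl⟩ := h
    simp [he.eq_iff]
  · push Not at h
    simp [h]

lemma poly_sq {T J : Type*} [Fintype T] [Fintype J] (e : T → J → ℕ)
    (he : ∀ t, Function.Injective (e t)) (c : T → J → 𝕂) (p : Polynomial 𝕂)
    (hp : p = ∑ t, ∑ j, Polynomial.C (c t j) * Polynomial.X ^ e t j) :
    ∑ k ∈ p.support, ‖p.coeff k‖ ^ 2 ≤ (Fintype.card T : ℝ) * ∑ t, ∑ j, ‖c t j‖ ^ 2 := by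
  rw [sum_support p _ (Nat.lt_succ_self _)]
  have h1 : ∀ l, ‖p.coeff l‖ ^ 2 ≤
      (Fintype.card T : ℝ) * ∑ t, ∑ j, (if l = e t j then ‖c t j‖ ^ 2 else 0) := by
    intro l
    have e1 : p.coeff l = ∑ t, ∑ j, (if l = e t j then c t j else 0) := by
      rw [hp]
      simp [Polynomial.finsetSum_coeff, Polynomial.coeff_X_pow]
    rw [e1]
    have e2 := pow_le_pow_left₀ (norm_nonneg _)
      (norm_sum_le Finset.univ (fun t => ∑ j, (if l = e t j then c t j else 0))) 2
    refine e2.trans ?_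
    refine sq_sum_le_card_mul_sum_sq.trans ?_
    simp only [one_hot _ (he _)]
    exact le_rfl
  refine (Finset.sum_le_sum fun l _ => h1 l).trans ?_
  rw [← Finset.mul_sum]
  refine mul_le_mul_of_nonneg_left ?_ (by positivity)
  rw [Finset.sum_comm]
  refine Finset.sum_le_sum fun t _ => ?_
  rw [Finset.sum_comm]
  refine Finset.sum_le_sum fun j _ => ?_
  rw [Finset.sum_ite_eq' ]
  split_ifs
  · exact le_rfl
  · positivity

lemma swap4 {a b c d : Type*} [Fintype a] [Fintype b] [Fintype c] [Fintype d]
    (f : a → b → c → d → ℝ) :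
    ∑ y, ∑ w, ∑ x, ∑ z, f x y z w = ∑ x, ∑ y, ∑ z, ∑ w, f x y z w := by
  rw [Finset.sum_comm (f := fun x y => ∑ z, ∑ w, f x y z w)]
  refine Finset.sum_congr rfl fun y _ => ?_
  rw [Finset.sum_comm]
  refine Finset.sum_congr rfl fun x _ => ?_
  rw [Finset.sum_comm]

lemma Q_bound (ε n η m : ℕ)
    (N : Fin 2 → Matrix (Fin (η + 1) × Fin m) (Fin (ε + 1) × Fin n) 𝕂) :
    polyFrob (QpolyOf 𝕂 ε n η m (toP N)) ≤ 2 * Real.sqrt ((ε + η + 1 : ℕ) : ℝ) * pn N := by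
  have key : ∀ x y, ∑ k ∈ (QpolyOf 𝕂 ε n η m (toP N) x y).support,
      ‖(QpolyOf 𝕂 ε n η m (toP N) x y).coeff k‖ ^ 2 ≤
      ((Fintype.card (Fin (η + 1) × Fin 2) : ℕ) : ℝ) *
        ∑ t : Fin (η + 1) × Fin 2, ∑ j, ‖N t.2 (t.1, x.2) (j, y.2)‖ ^ 2 := by
    intro x y
    refine poly_sq (T := Fin (η + 1) × Fin 2) (J := Fin (ε + 1))
      (fun t j => (η - (t.1 : ℕ)) + (ε - (j : ℕ)) + (t.2 : ℕ)) ?_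
      (fun t j => N t.2 (t.1, x.2) (j, y.2)) _ ?_
    · intro t a b h
      simp only at h
      ext
      have := a.2
      have := b.2
      omega
    · rw [Q_apply, Fintype.sum_prod_type]
      refine Finset.sum_congr rfl fun i _ => ?_
      rw [Finset.sum_comm]
      refine Finset.sum_congr rfl fun j _ => ?_
      rw [Fin.sum_univ_two]
      simp only [toP, Matrix.of_apply, Fin.val_zero, Fin.val_one, pow_add, pow_zero, pow_one]
      ring
  rw [show (2 : ℝ) * Real.sqrt ((ε + η + 1 : ℕ) : ℝ) = Real.sqrt (4 * ((ε + η + 1 : ℕ) : ℝ)) by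
    rw [Real.sqrt_mul (by norm_num), show (4 : ℝ) = 2 ^ 2 by norm_num, Real.sqrt_sq (by norm_num)]]
  unfold polyFrob pn
  rw [← Real.sqrt_mul (by positivity)]
  refine Real.sqrt_le_sqrt ?_
  refine (Finset.sum_le_sum fun x _ => Finset.sum_le_sum fun y _ => key x y).trans ?_
  simp only [← Finset.mul_sum]
  refine mul_le_mul ?_ (le_of_eq ?_) (by positivity) (by positivity)
  · simp only [Fintype.card_prod, Fintype.card_fin]
    push_cast
    linarith [(Nat.cast_nonneg ε : (0 : ℝ) ≤ ε), (Nat.cast_nonneg η : (0 : ℝ) ≤ η)]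
  · simp only [fsq, Fintype.sum_prod_type, Fin.sum_univ_two, Finset.sum_add_distrib, Finset.univ_unique, Finset.sum_singleton]
    rw [swap4 fun i a j b => ‖N 0 (i, a) (j, b)‖ ^ 2, swap4 fun i a j b => ‖N 1 (i, a) (j, b)‖ ^ 2]

end PH
end BK17

namespace BK17

lemma final_num (d : ℕ) (hd : 3 ≤ d) (δ μ : ℝ) (hμ : 0 ≤ μ)
    (h : δ < (Real.sqrt 2 - 1) ^ 2 * (1 / (d : ℝ) ^ ((5 : ℝ) / 2)) * (1 / (1 + μ))) :
    (d : ℝ) ^ 2 * δ * (1 + μ) ≤ 1 / 10 := by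
  have hd' : (3 : ℝ) ≤ d := by exact_mod_cast hd
  have hd0 : (0 : ℝ) < d := by linarith
  have h52 : (d : ℝ) ^ ((5 : ℝ) / 2) = (d : ℝ) ^ 2 * Real.sqrt d := by
    rw [show (5 : ℝ) / 2 = 2 + 1 / 2 by norm_num, Real.rpow_add hd0, Real.sqrt_eq_rpow]
    norm_num
  rw [h52] at h
  have hs : 1.732 ≤ Real.sqrt d := by
    apply Real.le_sqrt_of_sq_le
    norm_num; linarith
  have hs0 : 0 < Real.sqrt d := by linarith
  have h2 : (Real.sqrt 2 - 1) ^ 2 ≤ 0.1732 := by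
    have a : Real.sqrt 2 ≤ 1.41422 := by rw [Real.sqrt_le_left (by norm_num)]; norm_num
    have b : 1 ≤ Real.sqrt 2 := by rw [Real.le_sqrt' (by norm_num)]; norm_num
    have : (Real.sqrt 2 - 1) ^ 2 ≤ 0.41422 ^ 2 := pow_le_pow_left₀ (by linarith) (by linarith) 2
    refine this.trans (by norm_num)
  have h3 : (d : ℝ) ^ 2 * δ * (1 + μ) ≤ (Real.sqrt 2 - 1) ^ 2 / Real.sqrt d := by
    have := mul_le_mul_of_nonneg_left h.le (show 0 ≤ (d : ℝ) ^ 2 * (1 + μ) by positivity)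
    have e : (d : ℝ) ^ 2 * (1 + μ) * ((Real.sqrt 2 - 1) ^ 2 * (1 / ((d : ℝ) ^ 2 * Real.sqrt d)) * (1 / (1 + μ)))
        = (Real.sqrt 2 - 1) ^ 2 / Real.sqrt d := by
      have : 1 + μ ≠ 0 := by positivity
      field_simp
    rw [e] at this
    linarith
  refine h3.trans ?_
  rw [div_le_iff₀ hs0]
  linarith

end BK17

open BK17

/-- **Theorem `thm:perturbation`.** Let `L(λ)` be the `(ε,n,η,m)`-block
Kronecker pencil with `(1,1)` block the pencil `M = λM₁+M₀`, `d = ε+η+1`, and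
`P(λ) = (Λ_ηᵀ⊗I_m)(λM₁+M₀)(Λ_ε⊗I_n)`. If a pencil `ΔL(λ)` satisfies
`‖ΔL‖_F < (√2−1)²·d^{-5/2}/(1+‖M‖_F)`, then there is a matrix polynomial `ΔP(λ)` of grade `d`
such that `L+ΔL` is a strong linearization of `P+ΔP` (regarded as grade `d`) and
`‖ΔP‖_F ≤ 14·d^{5/2}·(1+‖M‖_F+‖M‖_F²)·‖ΔL‖_F`. -/
theorem statement_17 {𝕂 : Type*} [RCLike 𝕂] (m n ε η d : ℕ)
    (hm : 1 ≤ m) (hn : 1 ≤ n) (hε : 1 ≤ ε) (hη : 1 ≤ η) (hd : d = ε + η + 1)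
    (M : Matrix (Fin (η + 1) × Fin m) (Fin (ε + 1) × Fin n) (Polynomial 𝕂))
    (hM : ∀ i j, (M i j).natDegree ≤ 1)
    (ΔL : Matrix ((Fin (η + 1) × Fin m) ⊕ (Fin ε × Fin n))
      ((Fin (ε + 1) × Fin n) ⊕ (Fin η × Fin m)) (Polynomial 𝕂))
    (hΔLdeg : ∀ i j, (ΔL i j).natDegree ≤ 1)
    (hΔLsmall : polyFrob ΔL <
      (Real.sqrt 2 - 1) ^ 2 * (1 / (d : ℝ) ^ ((5 : ℝ) / 2)) * (1 / (1 + polyFrob M))) :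
    ∃ ΔP : Matrix (Fin 1 × Fin m) (Fin 1 × Fin n) (Polynomial 𝕂),
      (∀ i j, (ΔP i j).natDegree ≤ d) ∧
      IsLinearization (blockKron 𝕂 ε n η m M + ΔL) (QpolyOf 𝕂 ε n η m M + ΔP) ∧
      IsLinearization (revMat 1 (blockKron 𝕂 ε n η m M + ΔL))
        (revMat d (QpolyOf 𝕂 ε n η m M + ΔP)) ∧
      polyFrob ΔP ≤
        14 * (d : ℝ) ^ ((5 : ℝ) / 2) * (1 + polyFrob M + polyFrob M ^ 2) * polyFrob ΔL := by
  have hd3 : 3 ≤ d := by omega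
  have hμ := polyFrob_pc M hM
  have hδ := polyFrob_pc ΔL hΔLdeg
  have hμ0 : 0 ≤ polyFrob M := Real.sqrt_nonneg _
  have hδ0 : 0 ≤ polyFrob ΔL := Real.sqrt_nonneg _
  have hs := final_num d hd3 _ _ hμ0 hΔLsmall
  obtain ⟨δ, hδe⟩ : ∃ δ, δ = polyFrob ΔL := ⟨_, rfl⟩
  rw [← hδe] at hs hδ hδ0 ⊢
  have b11 := pn_sub_le (pc ΔL) Sum.inl Sum.inl Sum.inl_injective Sum.inl_injective
  have b12 := pn_sub_le (pc ΔL) Sum.inl Sum.inr Sum.inl_injective Sum.inr_injective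
  have b21 := pn_sub_le (pc ΔL) Sum.inr Sum.inl Sum.inr_injective Sum.inl_injective
  have b22 := pn_sub_le (pc ΔL) Sum.inr Sum.inr Sum.inr_injective Sum.inr_injective
  rw [← hδ] at b11 b12 b21 b22
  rw [hμ, hd] at hs
  obtain ⟨X, Y, M', hX, hY, hXY, hb⟩ := pencil_main ε η n m hε hη δ (pc M) _ _ _ _ b11 b12 b21 b22 hs
  have hpoly : X.map Polynomial.C * (blockKron 𝕂 ε n η m M + ΔL) * Y.map Polynomial.C =
      blockKron 𝕂 ε n η m (toP M') := by
    have hadd : ∀ k, cf k (blockKron 𝕂 ε n η m M + ΔL) = cf k (blockKron 𝕂 ε n η m M) + cf k ΔL := by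
      intro k; ext i j; simp [cf]
    have h2 : ∀ k : Fin 2, cf k (X.map Polynomial.C * (blockKron 𝕂 ε n η m M + ΔL) *
        Y.map Polynomial.C) = cf k (blockKron 𝕂 ε n η m (toP M')) := by
      intro k
      rw [cf_rmul, cf_lmul, hadd, cf_blockKron, cf_blockKron, cf_toP, ← hXY k]
      congr 2
      ext (i | i) (j | j) <;> simp [pc]
    apply cf_ext
    intro k
    rcases Nat.lt_or_ge k 2 with hk | hk
    · exact h2 ⟨k, hk⟩
    · rw [cf_rmul, cf_lmul, hadd, cf_deg _ (blockKron_deg ε n η m M hM) k hk,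
        cf_deg _ hΔLdeg k hk, cf_deg _ (blockKron_deg ε n η m _ (toP_deg M')) k hk]
      simp
  have hQ : QpolyOf 𝕂 ε n η m M + QpolyOf 𝕂 ε n η m (toP (M' - pc M)) =
      QpolyOf 𝕂 ε n η m (toP M') := by
    have : toP M' = M + toP (M' - pc M) := by
      apply cf_ext
      have hadd : ∀ k, cf k (M + toP (M' - pc M)) = cf k M + cf k (toP (M' - pc M)) := by
        intro k; ext i j; simp [cf]
      intro k
      rw [hadd]
      rcases Nat.lt_or_ge k 2 with hk | hk
      · have e1 := cf_toP M' ⟨k, hk⟩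
        have e2 := cf_toP (M' - pc M) ⟨k, hk⟩
        simp only at e1 e2
        rw [e1, e2]
        simp [pc]
      · rw [cf_deg _ (toP_deg M') k hk, cf_deg _ hM k hk, cf_deg _ (toP_deg _) k hk]
        simp
    rw [this]
    simp [QpolyOf, Matrix.mul_add, Matrix.add_mul]
  refine ⟨QpolyOf 𝕂 ε n η m (toP (M' - pc M)), ?_, ?_, ?_, ?_⟩
  · intro x y
    rw [Q_apply]
    refine Polynomial.natDegree_sum_le_of_forall_le _ _ fun i _ =>
      Polynomial.natDegree_sum_le_of_forall_le _ _ fun j _ => ?_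
    refine Polynomial.natDegree_mul_le.trans ?_
    have := toP_deg (M' - pc M) (i, x.2) (j, y.2)
    rw [Polynomial.natDegree_X_pow]
    omega
  · rw [hQ]
    exact lin_transfer _ _ _ _ _ (det_map_C X hX) (det_map_C Y hY) hpoly
      (lin_blockKron ε n η m (toP M'))
  · rw [hQ, hd]
    refine lin_transfer _ _ _ _ _ (det_map_C X hX) (det_map_C Y hY) ?_
      (lin_rev ε n η m (toP M') (toP_deg M'))
    rw [← hpoly, rev_mul]
  · refine (Q_bound ε n η m (M' - pc M)).trans ?_
    rw [← hμ, ← hd] at hb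
    rw [← hd]
    have hd0 : (0 : ℝ) < d := by
      have : 0 < d := by omega
      exact_mod_cast this
    have h52 : (d : ℝ) ^ ((5 : ℝ) / 2) = (d : ℝ) ^ 2 * Real.sqrt d := by
      rw [show (5 : ℝ) / 2 = 2 + 1 / 2 by norm_num, Real.rpow_add hd0, Real.sqrt_eq_rpow]
      norm_num
    rw [h52]
    refine (mul_le_mul_of_nonneg_left hb (by positivity)).trans (le_of_eq ?_)
    ring
end

section
/- Let ε, η ≥ 1 be integers, let J_k ∈ ℝ^{k×k} be the lower shift matrix with (J_k)_{i+1,i} = 1 for i = 1,…,k−1 and all other entries 0 (so J_1 = 0), and let W := I_ε ⊗ J_η + J_ε ⊗ I_η ∈ ℝ^{εη×εη}. Then the spectral norm of W (its largest singular value, equivalently its ℓ²→ℓ² operator norm) equals 2·cos(π/(2·min(ε,η)+1)) if ε ≠ η, and equals 2·cos(π/(2η)) if ε = η. -/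
open Matrix
open scoped Kronecker

/-- The `k×k` lower shift matrix `J_k` with ones on the first subdiagonal. -/
def Jk (k : ℕ) : Matrix (Fin k) (Fin k) ℝ :=
  Matrix.of fun i j => if (i : ℕ) = (j : ℕ) + 1 then 1 else 0


lemma schur_upper {ι : Type*} [Fintype ι] (W : Matrix ι ι ℝ) (u v : ι → ℝ) (c : ℝ)
    (hc : 0 ≤ c) (hW : ∀ p q, 0 ≤ W p q) (hu : ∀ q, 0 < u q)
    (h1 : ∀ p, (W *ᵥ u) p ≤ c * v p) (h2 : ∀ q, (Wᵀ *ᵥ v) q ≤ c * u q) (x : ι → ℝ) :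
    evnorm (W *ᵥ x) ≤ c * evnorm x := by
  unfold evnorm
  rw [← Real.sqrt_sq hc, ← Real.sqrt_mul (sq_nonneg c)]
  apply Real.sqrt_le_sqrt
  simp only [Real.norm_eq_abs, sq_abs]
  have e1 : ∀ p, ((W *ᵥ x) p) ^ 2 ≤ (c * v p) * ∑ q, W p q * (x q ^ 2 / u q) := by
    intro p
    have hs : 0 ≤ ∑ q, W p q * (x q ^ 2 / u q) :=
      Finset.sum_nonneg fun q _ => mul_nonneg (hW p q) (div_nonneg (sq_nonneg _) (hu q).le)
    refine le_trans ?_ (mul_le_mul_of_nonneg_right (h1 p) hs)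
    simp only [Matrix.mulVec, dotProduct]
    apply Finset.sum_sq_le_sum_mul_sum_of_sq_eq_mul
    · exact fun q _ => mul_nonneg (hW p q) (hu q).le
    · exact fun q _ => mul_nonneg (hW p q) (div_nonneg (sq_nonneg _) (hu q).le)
    · intro q _
      have := (hu q).ne'
      field_simp
  calc ∑ p, ((W *ᵥ x) p) ^ 2 ≤ ∑ p, (c * v p) * ∑ q, W p q * (x q ^ 2 / u q) :=
        Finset.sum_le_sum fun p _ => e1 p
    _ = ∑ q, c * (x q ^ 2 / u q) * (Wᵀ *ᵥ v) q := by
        simp only [Matrix.mulVec, dotProduct, Finset.mul_sum, Matrix.transpose_apply]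
        rw [Finset.sum_comm]
        refine Finset.sum_congr rfl fun q _ => Finset.sum_congr rfl fun p _ => by ring
    _ ≤ ∑ q, c * (x q ^ 2 / u q) * (c * u q) :=
        Finset.sum_le_sum fun q _ => mul_le_mul_of_nonneg_left (h2 q)
          (mul_nonneg hc (div_nonneg (sq_nonneg _) (hu q).le))
    _ = c ^ 2 * ∑ q, x q ^ 2 := by
        rw [Finset.mul_sum]
        refine Finset.sum_congr rfl fun q _ => ?_
        have := (hu q).ne'
        field_simp

lemma sing_lower {ι : Type*} [Fintype ι] (W : Matrix ι ι ℝ) (u v : ι → ℝ) (c : ℝ)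
    (hc : 0 ≤ c) (q0 : ι) (hu : u q0 ≠ 0)
    (h1 : ∀ p, (W *ᵥ u) p = c * v p) (h2 : ∀ q, (Wᵀ *ᵥ v) q = c * u q)
    (d : ℝ) (hd0 : 0 ≤ d) (hd : ∀ x : ι → ℝ, evnorm (W *ᵥ x) ≤ d * evnorm x) : c ≤ d := by
  rcases hc.eq_or_lt with rfl | hc'
  · exact hd0
  have e1 : W *ᵥ u = c • v := funext h1
  have e2 : Wᵀ *ᵥ v = c • u := funext h2
  have e3 : v ⬝ᵥ v = u ⬝ᵥ u := by
    have a : v ⬝ᵥ (W *ᵥ u) = (Wᵀ *ᵥ v) ⬝ᵥ u := by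
      rw [Matrix.dotProduct_mulVec, Matrix.mulVec_transpose]
    rw [e1, e2, dotProduct_smul, smul_dotProduct] at a
    simpa [hc'.ne'] using a
  have ev : ∀ y : ι → ℝ, evnorm y = Real.sqrt (y ⬝ᵥ y) := by
    intro y
    simp [evnorm, dotProduct, sq]
  have pos : 0 < evnorm u := by
    unfold evnorm
    apply Real.sqrt_pos.2
    apply Finset.sum_pos' (fun i _ => by positivity)
    exact ⟨q0, Finset.mem_univ _, by positivity⟩
  have := hd u
  have e4 : evnorm (W *ᵥ u) = c * evnorm u := by
    rw [e1, ev, ev, smul_dotProduct, dotProduct_smul, e3, smul_eq_mul, smul_eq_mul, ← mul_assoc,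
      Real.sqrt_mul (by positivity), Real.sqrt_mul_self hc]
  rw [e4] at this
  exact le_of_mul_le_mul_right this pos

lemma sumJ (k : ℕ) (i : Fin k) (f : ℕ → ℝ) :
    ∑ j : Fin k, Jk k i j * f j = if 1 ≤ (i : ℕ) then f (i - 1) else 0 := by
  simp only [Jk, Matrix.of_apply, ite_mul, one_mul, zero_mul]
  split_ifs with h
  · rw [Finset.sum_eq_single (⟨i - 1, by omega⟩ : Fin k)]
    · rw [if_pos]; simp; omega
    · intro b _ hb
      rw [if_neg]
      intro h'
      apply hb; ext; simp; omega
    · simp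
  · apply Finset.sum_eq_zero
    intro j _
    rw [if_neg]; omega

lemma sumJT (k : ℕ) (i : Fin k) (f : ℕ → ℝ) :
    ∑ j : Fin k, Jk k j i * f j = if (i : ℕ) + 1 < k then f (i + 1) else 0 := by
  simp only [Jk, Matrix.of_apply, ite_mul, one_mul, zero_mul]
  split_ifs with h
  · rw [Finset.sum_eq_single (⟨i + 1, h⟩ : Fin k)]
    · rw [if_pos]; simp
    · intro b _ hb
      rw [if_neg]
      intro h'
      apply hb; ext; simp; omega
    · simp
  · apply Finset.sum_eq_zero
    intro j _
    rw [if_neg]; omega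

/-- the matrix W -/
abbrev Wm (ε η : ℕ) : Matrix (Fin ε × Fin η) (Fin ε × Fin η) ℝ :=
  (1 : Matrix (Fin ε) (Fin ε) ℝ) ⊗ₖ Jk η + Jk ε ⊗ₖ (1 : Matrix (Fin η) (Fin η) ℝ)

lemma W_apply (ε η : ℕ) (X : ℕ → ℕ → ℝ) (p : Fin ε × Fin η) :
    (Wm ε η *ᵥ fun q => X q.1 q.2) p =
      (if 1 ≤ (p.2 : ℕ) then X p.1 (p.2 - 1) else 0) +
      (if 1 ≤ (p.1 : ℕ) then X (p.1 - 1) p.2 else 0) := by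
  rw [← sumJ η p.2 (fun j => X p.1 j), ← sumJ ε p.1 (fun i => X i p.2)]
  rw [Matrix.add_mulVec, Pi.add_apply]
  simp only [Matrix.mulVec, dotProduct, Fintype.sum_prod_type, Matrix.kroneckerMap_apply,
    Matrix.one_apply]
  congr 1
  · rw [Finset.sum_eq_single p.1]
    · simp
    · intro b _ hb; simp [hb.symm]
    · simp
  · refine Finset.sum_congr rfl fun i _ => ?_
    simp

lemma WT_apply (ε η : ℕ) (X : ℕ → ℕ → ℝ) (p : Fin ε × Fin η) :
    ((Wm ε η)ᵀ *ᵥ fun q => X q.1 q.2) p =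
      (if (p.2 : ℕ) + 1 < η then X p.1 (p.2 + 1) else 0) +
      (if (p.1 : ℕ) + 1 < ε then X (p.1 + 1) p.2 else 0) := by
  rw [← sumJT η p.2 (fun j => X p.1 j), ← sumJT ε p.1 (fun i => X i p.2)]
  rw [Matrix.transpose_add, Matrix.add_mulVec, Pi.add_apply]
  simp only [Matrix.mulVec, dotProduct, Fintype.sum_prod_type, Matrix.kroneckerMap_apply,
    Matrix.one_apply, Matrix.transpose_apply]
  congr 1
  · rw [Finset.sum_eq_single p.1]
    · simp
    · intro b _ hb; simp [hb]
    · simp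
  · refine Finset.sum_congr rfl fun i _ => ?_
    simp

lemma master (ε η s : ℕ) (c : ℝ) (hc : 0 ≤ c) (U V : ℕ → ℕ → ℝ)
    (hU : ∀ i j, i < ε → j < η → 0 < U i j)
    (h1 : ∀ i j, i < ε → j < η →
      (if 1 ≤ j then U i (j - 1) else 0) + (if 1 ≤ i then U (i - 1) j else 0) ≤ c * V i j)
    (h2 : ∀ i j, i < ε → j < η →
      (if j + 1 < η then V i (j + 1) else 0) + (if i + 1 < ε then V (i + 1) j else 0)
        ≤ c * U i j)
    (h3 : ∀ i j, i < ε → j < η → i + j = s + 1 →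
      (if 1 ≤ j then U i (j - 1) else 0) + (if 1 ≤ i then U (i - 1) j else 0) = c * V i j)
    (h4 : ∀ i j, i < ε → j < η → i + j = s →
      (if j + 1 < η then V i (j + 1) else 0) + (if i + 1 < ε then V (i + 1) j else 0)
        = c * U i j)
    (h5 : ∃ i j, i < ε ∧ j < η ∧ i + j = s) :
    specNorm (Wm ε η) = c := by
  unfold specNorm
  apply IsLeast.csInf_eq
  refine ⟨⟨hc, ?_⟩, ?_⟩
  · apply schur_upper _ (fun q => U q.1 q.2) (fun q => V q.1 q.2) c hc
    · intro p q
      simp only [Wm, Matrix.add_apply, Matrix.kroneckerMap_apply, Matrix.one_apply, Jk,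
        Matrix.of_apply]
      positivity
    · exact fun q => hU _ _ q.1.2 q.2.2
    · intro p; rw [W_apply]; exact h1 _ _ p.1.2 p.2.2
    · intro p; rw [WT_apply]; exact h2 _ _ p.1.2 p.2.2
  · rintro d ⟨hd0, hd⟩
    obtain ⟨i, j, hi, hj, hij⟩ := h5
    apply sing_lower (Wm ε η)
      (fun q => (fun a b => if a + b = s then U a b else 0 : ℕ → ℕ → ℝ) q.1 q.2)
      (fun q => (fun a b => if a + b = s + 1 then V a b else 0 : ℕ → ℕ → ℝ) q.1 q.2) c hc
      (⟨i, hi⟩, ⟨j, hj⟩) ?_ ?_ ?_ d hd0 hd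
    · simpa [hij] using (hU i j hi hj).ne'
    · intro p
      refine (W_apply ε η (fun a b => if a + b = s then U a b else 0) p).trans ?_
      have := h3 _ _ p.1.2 p.2.2
      generalize (p.1 : ℕ) = a at *
      generalize (p.2 : ℕ) = b at *
      dsimp only
      by_cases hs : a + b = s + 1
      · rw [if_pos hs, ← this hs]
        congr 1
        · split_ifs <;> first | rfl | omega
        · split_ifs <;> first | rfl | omega
      · rw [if_neg hs]
        have e1 : 1 ≤ b → ¬ (a + (b - 1) = s) := by omega
        have e2 : 1 ≤ a → ¬ (a - 1 + b = s) := by omega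
        split_ifs <;> simp_all
    · intro p
      refine (WT_apply ε η (fun a b => if a + b = s + 1 then V a b else 0) p).trans ?_
      have := h4 _ _ p.1.2 p.2.2
      generalize (p.1 : ℕ) = a at *
      generalize (p.2 : ℕ) = b at *
      dsimp only
      have e1 : a + (b + 1) = s + 1 ↔ a + b = s := by omega
      have e2 : a + 1 + b = s + 1 ↔ a + b = s := by omega
      simp only [e1, e2]
      by_cases hs : a + b = s
      · simp only [if_pos hs]; exact this hs
      · simp [if_neg hs]

lemma cos_step (a t : ℝ) : Real.cos (a + t) + Real.cos (a - t) = 2 * Real.cos t * Real.cos a := by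
  rw [Real.cos_add, Real.cos_sub]; ring

lemma sin_step (a t : ℝ) : Real.sin (a + t) + Real.sin (a - t) = 2 * Real.cos t * Real.sin a := by
  rw [Real.sin_add, Real.sin_sub]; ring

lemma square_case (n : ℕ) (hn : 1 ≤ n) :
    specNorm (Wm n n) = 2 * Real.cos (Real.pi / (2 * (n : ℝ))) := by
  have hn' : (1 : ℝ) ≤ n := by exact_mod_cast hn
  set θ := Real.pi / (2 * (n : ℝ)) with hθ
  have hθ0 : 0 < θ := by have := Real.pi_pos; positivity
  have hnθ : (n : ℝ) * θ = Real.pi / 2 := by rw [hθ]; field_simp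
  have cnn : ∀ x : ℝ, -n ≤ x → x ≤ n → 0 ≤ Real.cos (x * θ) := by
    intro x h1 h2
    apply Real.cos_nonneg_of_mem_Icc
    constructor <;> nlinarith
  have cp : ∀ x : ℝ, -n < x → x < n → 0 < Real.cos (x * θ) := by
    intro x h1 h2
    apply Real.cos_pos_of_mem_Ioo
    constructor <;> nlinarith
  have hc : 0 ≤ 2 * Real.cos θ := by
    have := cnn 1 (by linarith) (by linarith)
    rw [one_mul] at this; linarith
  have st : ∀ x : ℝ, Real.cos ((x + 1) * θ) + Real.cos ((x - 1) * θ)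
      = 2 * Real.cos θ * Real.cos (x * θ) := by
    intro x
    rw [← cos_step]; congr 2 <;> ring
  have dn : ∀ (P : Prop) [Decidable P] (x : ℝ), 0 ≤ x → (if P then x else 0) ≤ x := by
    intro P _ x hx; split_ifs <;> simp [hx]
  have h1 : ∀ i j, i < n → j < n → 
      (if 1 ≤ j then Real.cos (((i : ℝ) - (j - 1 : ℕ)) * θ) else 0) + 
      (if 1 ≤ i then Real.cos ((((i - 1 : ℕ) : ℝ) - j) * θ) else 0)
       = (if 1 ≤ j then Real.cos (((i : ℝ) - j + 1) * θ) else 0) + 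
      (if 1 ≤ i then Real.cos (((i : ℝ) - j - 1) * θ) else 0) := by
    intro i j hi hj
    congr 1
    · split_ifs with h
      · push_cast [h]; congr 2; ring
      · rfl
    · split_ifs with h
      · push_cast [h]; congr 2; ring
      · rfl
  have h2 : ∀ i j, i < n → j < n → 
      (if j + 1 < n then Real.cos (((i : ℝ) - (j + 1 : ℕ)) * θ) else 0) + 
      (if i + 1 < n then Real.cos ((((i + 1 : ℕ) : ℝ) - j) * θ) else 0)
       = (if i + 1 < n then Real.cos (((i : ℝ) - j + 1) * θ) else 0) + 
      (if j + 1 < n then Real.cos (((i : ℝ) - j - 1) * θ) else 0) := by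
    intro i j hi hj
    rw [add_comm]
    congr 1
    · split_ifs with h
      · push_cast; congr 2; ring
      · rfl
    · split_ifs with h
      · push_cast; congr 2; ring
      · rfl
  have bd : ∀ i j, i < n → j < n → 0 ≤ Real.cos (((i : ℝ) - j + 1) * θ) ∧
      0 ≤ Real.cos (((i : ℝ) - j - 1) * θ) := by
    intro i j hi hj
    have a1 : (i : ℝ) + 1 ≤ n := by exact_mod_cast hi
    have a2 : (j : ℝ) + 1 ≤ n := by exact_mod_cast hj
    have a3 : (0 : ℝ) ≤ i := by positivity
    have a4 : (0 : ℝ) ≤ j := by positivity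
    exact ⟨cnn _ (by linarith) (by linarith), cnn _ (by linarith) (by linarith)⟩
  apply master n n (n - 1) _ hc (fun i j => Real.cos (((i : ℝ) - j) * θ))
    (fun i j => Real.cos (((i : ℝ) - j) * θ))
  · intro i j hi hj
    have a1 : (i : ℝ) + 1 ≤ n := by exact_mod_cast hi
    have a2 : (j : ℝ) + 1 ≤ n := by exact_mod_cast hj
    have a3 : (0 : ℝ) ≤ i := by positivity
    have a4 : (0 : ℝ) ≤ j := by positivity
    exact cp _ (by linarith) (by linarith)
  · intro i j hi hj
    rw [h1 i j hi hj, ← st]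
    exact add_le_add (dn _ _ (bd i j hi hj).1) (dn _ _ (bd i j hi hj).2)
  · intro i j hi hj
    rw [h2 i j hi hj, ← st]
    exact add_le_add (dn _ _ (bd i j hi hj).1) (dn _ _ (bd i j hi hj).2)
  · intro i j hi hj hij
    rw [h1 i j hi hj, ← st, if_pos (by omega), if_pos (by omega)]
  · intro i j hi hj hij
    rw [h2 i j hi hj, ← st]
    congr 1
    · split_ifs with h
      · rfl
      · have hi' : (i : ℝ) + 1 = n := by exact_mod_cast (by omega : i + 1 = n)
        have hj' : j = 0 := by omega
        subst hj'
        rw [Nat.cast_zero, sub_zero, hi', hnθ, Real.cos_pi_div_two]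
    · split_ifs with h
      · rfl
      · have hj' : (j : ℝ) + 1 = n := by exact_mod_cast (by omega : j + 1 = n)
        have hi' : i = 0 := by omega
        subst hi'
        rw [show (((0 : ℕ) : ℝ) - j - 1) * θ = -(n * θ) by rw [← hj']; push_cast; ring,
          Real.cos_neg, hnθ, Real.cos_pi_div_two]
  · exact ⟨0, n - 1, by omega, by omega, by omega⟩

lemma rect_case (m : ℕ) (hm : 1 ≤ m) (c : ℝ) (hcd : c = 2 * Real.cos (Real.pi / (2 * (m : ℝ) + 1))) :
    0 ≤ c ∧ ∃ u v : ℕ → ℝ, (∀ i < m, 0 < u i) ∧ (∀ i < m, 0 < v i) ∧ v m = 0 ∧ v 0 = v 0 ∧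
      (u 0 = c * v 0) ∧ (∀ i, u (i + 1) + u i = c * v (i + 1)) ∧
      (∀ i, v i + v (i + 1) = c * u i) := by
  have hm' : (1 : ℝ) ≤ m := by exact_mod_cast hm
  set θ := Real.pi / (2 * (m : ℝ) + 1) with hθ
  have hθ0 : 0 < θ := by have := Real.pi_pos; positivity
  have hmθ : (2 * (m : ℝ) + 1) * θ = Real.pi := by rw [hθ]; field_simp
  have sp : ∀ x : ℝ, 0 < x → x < 2 * m + 1 → 0 < Real.sin (x * θ) := by
    intro x h1 h2
    apply Real.sin_pos_of_pos_of_lt_pi <;> nlinarith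
  have st : ∀ x : ℝ, Real.sin ((x + 1) * θ) + Real.sin ((x - 1) * θ)
      = c * Real.sin (x * θ) := by
    intro x
    rw [hcd, ← sin_step]; congr 2 <;> ring
  refine ⟨?_, fun i => Real.sin ((2 * i + 2) * θ), fun i => Real.sin ((2 * i + 1) * θ),
    ?_, ?_, ?_, rfl, ?_, ?_, ?_⟩
  · rw [hcd]
    have : 0 ≤ Real.cos θ := by
      apply Real.cos_nonneg_of_mem_Icc
      constructor <;> nlinarith
    linarith
  · intro i hi
    have a1 : (i : ℝ) + 1 ≤ m := by exact_mod_cast hi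
    exact sp _ (by positivity) (by linarith)
  · intro i hi
    have a1 : (i : ℝ) + 1 ≤ m := by exact_mod_cast hi
    exact sp _ (by positivity) (by linarith)
  · simp only [hmθ, Real.sin_pi]
  · have := st 1
    norm_num at this ⊢
    linarith
  · intro i
    rw [← st]; push_cast; congr 3 <;> ring
  · intro i
    rw [← st, add_comm]; push_cast; congr 3 <;> ring

/-- **Proposition `prop:normW`.** For `W = I_ε⊗J_η + J_ε⊗I_η`, the spectral
norm of `W` equals `2cos(π/(2min(ε,η)+1))` if `ε ≠ η` and `2cos(π/(2η))` if `ε = η`. -/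
theorem statement_18 (ε η : ℕ) (hε : 1 ≤ ε) (hη : 1 ≤ η) :
    specNorm ((1 : Matrix (Fin ε) (Fin ε) ℝ) ⊗ₖ Jk η + Jk ε ⊗ₖ (1 : Matrix (Fin η) (Fin η) ℝ)) =
      if ε = η then 2 * Real.cos (Real.pi / (2 * (η : ℝ)))
      else 2 * Real.cos (Real.pi / (2 * ((min ε η : ℕ) : ℝ) + 1)) := by
  change specNorm (Wm ε η) = _
  split_ifs with h
  · subst h
    exact square_case ε hε
  obtain ⟨hc, u, v, hu, hv, vm, -, e0, e1, e2⟩ := rect_case (min ε η) (by omega) _ rfl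
  set c := 2 * Real.cos (Real.pi / (2 * ((min ε η : ℕ) : ℝ) + 1)) with hcdef
  clear_value c
  rcases lt_or_gt_of_ne h with hlt | hlt
  · rw [min_eq_left hlt.le] at *
    have e1' : ∀ i, (u i + if 1 ≤ i then u (i - 1) else 0) = c * v i := by
      intro i
      cases i with
      | zero => simp [e0]
      | succ k => simp [e1]
    have e2' : ∀ i < ε, (v i + if i + 1 < ε then v (i + 1) else 0) = c * u i := by
      intro i hi
      rw [← e2]
      congr 1
      split_ifs with h'
      · rfl
      · rw [show i + 1 = ε by omega, vm]
    apply master ε η (ε - 1) c hc (fun i _ => u i) (fun i _ => v i)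
    · exact fun i j hi _ => hu i hi
    · intro i j hi hj
      rw [← e1' i]
      have := (hu i hi).le
      gcongr
      split_ifs <;> simp [this]
    · intro i j hi hj
      rw [← e2' i hi]
      have := (hv i hi).le
      gcongr
      split_ifs <;> simp [this]
    · intro i j hi hj hij
      rw [← e1' i, if_pos (by omega : 1 ≤ j)]
    · intro i j hi hj hij
      rw [← e2' i hi, if_pos (by omega : j + 1 < η)]
    · exact ⟨0, ε - 1, by omega, by omega, by omega⟩
  · rw [min_eq_right hlt.le] at *
    have e1' : ∀ i, ((if 1 ≤ i then u (i - 1) else 0) + u i) = c * v i := by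
      intro i
      cases i with
      | zero => simp [e0]
      | succ k => rw [add_comm]; simp [e1]
    have e2' : ∀ i < η, ((if i + 1 < η then v (i + 1) else 0) + v i) = c * u i := by
      intro i hi
      rw [← e2, add_comm]
      congr 1
      split_ifs with h'
      · rfl
      · rw [show i + 1 = η by omega, vm]
    apply master ε η (η - 1) c hc (fun _ j => u j) (fun _ j => v j)
    · exact fun i j _ hj => hu j hj
    · intro i j hi hj
      rw [← e1' j]
      have := (hu j hj).le
      gcongr
      split_ifs <;> simp [this]
    · intro i j hi hj
      rw [← e2' j hj]
      have := (hv j hj).le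
      gcongr
      split_ifs <;> simp [this]
    · intro i j hi hj hij
      rw [← e1' j, if_pos (by omega : 1 ≤ i)]
    · intro i j hi hj hij
      rw [← e2' j hj, if_pos (by omega : i + 1 < ε)]
    · exact ⟨η - 1, 0, by omega, by omega, by omega⟩
end

section
/- Let 𝕂 be ℝ or ℂ, m, n ≥ 1, ε, η ≥ 0, d := ε+η+1. Let λM_1+M_0 be a pencil of size (η+1)m×(ε+1)n, let L(λ) be the associated (ε,n,η,m)-block Kronecker pencil, and let P(λ) := (Λ_η(λ)ᵀ⊗I_m)(λM_1+M_0)(Λ_ε(λ)⊗I_n). Then (a) ‖L(λ)‖_F² = ‖λM_1+M_0‖_F² + 2(nε + mη), and (b) ‖P(λ)‖_F ≤ √(2d)·‖λM_1+M_0‖_F; in particular ‖L(λ)‖_F ≥ ‖P(λ)‖_F/√(2d). -/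
open Polynomial Matrix
open scoped Kronecker

lemma le_of_sq_le_sq19 {a b : ℝ} (h : a ^ 2 ≤ b ^ 2) (hb : 0 ≤ b) : a ≤ b :=
  (le_abs_self a).trans (abs_le_of_sq_le_sq h hb)

noncomputable def psq19 {𝕂 : Type*} [RCLike 𝕂] (p : Polynomial 𝕂) : ℝ :=
  ∑ k ∈ p.support, ‖p.coeff k‖ ^ 2

lemma psq19_nonneg {𝕂 : Type*} [RCLike 𝕂] (p : Polynomial 𝕂) : 0 ≤ psq19 p :=
  Finset.sum_nonneg fun _ _ => by positivity

lemma psq19_zero {𝕂 : Type*} [RCLike 𝕂] : psq19 (0 : Polynomial 𝕂) = 0 := by simp [psq19]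

lemma psq19_le_one {𝕂 : Type*} [RCLike 𝕂] (p : Polynomial 𝕂) (hp : p.natDegree ≤ 1) :
    psq19 p = ∑ s : Fin 2, ‖p.coeff s‖ ^ 2 := by
  rw [Fin.sum_univ_eq_sum_range (fun s => ‖p.coeff s‖ ^ 2) 2]
  unfold psq19
  apply Finset.sum_subset
  · intro k hk
    have := Polynomial.le_natDegree_of_mem_supp k hk
    simp; omega
  · intro k _ hk
    simp at hk
    simp [hk]

lemma psq19_neg_one {𝕂 : Type*} [RCLike 𝕂] : psq19 (-1 : Polynomial 𝕂) = 1 := by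
  rw [psq19_le_one _ (by simp)]
  simp [Fin.sum_univ_two, Polynomial.coeff_one]

lemma psq19_X {𝕂 : Type*} [RCLike 𝕂] : psq19 (X : Polynomial 𝕂) = 1 := by
  rw [psq19_le_one _ (by simp)]
  simp [Fin.sum_univ_two]

lemma psq19_sum {𝕂 : Type*} [RCLike 𝕂] {T : Type*} [Fintype T] (g : T → ℕ) (c : T → 𝕂) (N : ℕ)
    (hN : ∀ k, (Finset.univ.filter fun t => g t = k).card ≤ N) :
    psq19 (∑ t, Polynomial.monomial (g t) (c t)) ≤ N * ∑ t, ‖c t‖ ^ 2 := by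
  set p : Polynomial 𝕂 := ∑ t, Polynomial.monomial (g t) (c t) with hp
  have h1 : ∀ k, ‖p.coeff k‖ ^ 2 ≤ N * ∑ t, if g t = k then ‖c t‖ ^ 2 else 0 := by
    intro k
    have : p.coeff k = ∑ t ∈ Finset.univ.filter (fun t => g t = k), c t := by
      rw [hp, Polynomial.finset_sum_coeff, Finset.sum_filter]
      simp [Polynomial.coeff_monomial]
    rw [this, ← Finset.sum_filter]
    calc _ ≤ (∑ t ∈ Finset.univ.filter (fun t => g t = k), ‖c t‖) ^ 2 := by
            gcongr; exact norm_sum_le _ _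
      _ ≤ _ := sq_sum_le_card_mul_sum_sq
      _ ≤ _ := by
        gcongr
        exact hN k
  calc psq19 p ≤ ∑ k ∈ p.support, N * ∑ t, (if g t = k then ‖c t‖ ^ 2 else 0) :=
        Finset.sum_le_sum fun k _ => h1 k
    _ = N * ∑ t, ∑ k ∈ p.support, (if g t = k then ‖c t‖ ^ 2 else 0) := by
        rw [← Finset.mul_sum, Finset.sum_comm]
    _ ≤ _ := by
        gcongr with t
        rw [Finset.sum_ite_eq]
        split_ifs
        · exact le_rfl
        · positivity

lemma polyFrob_sq19 {𝕂 : Type*} [RCLike 𝕂] {ι κ : Type*} [Fintype ι] [Fintype κ]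
    (P : Matrix ι κ (Polynomial 𝕂)) : polyFrob P ^ 2 = ∑ i, ∑ j, psq19 (P i j) := by
  unfold polyFrob
  rw [Real.sq_sqrt]
  · rfl
  · positivity

lemma Lk_sum19 {𝕂 : Type*} [RCLike 𝕂] (k n : ℕ) :
    ∑ i, ∑ j, psq19 ((Lk 𝕂 k ⊗ₖ (1 : Matrix (Fin n) (Fin n) (Polynomial 𝕂))) i j)
      = 2 * ((n : ℝ) * k) := by
  have h : ∀ (i : Fin k × Fin n) (j : Fin (k+1) × Fin n),
      psq19 ((Lk 𝕂 k ⊗ₖ (1 : Matrix (Fin n) (Fin n) (Polynomial 𝕂))) i j) =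
      ((if j = (i.1.castSucc, i.2) then 1 else 0) + (if j = (i.1.succ, i.2) then 1 else 0)) := by
    rintro ⟨i, a⟩ ⟨j, b⟩
    simp only [Matrix.kroneckerMap_apply, Lk, Matrix.of_apply, Matrix.one_apply, Prod.mk.injEq,
      Fin.ext_iff, Fin.val_castSucc, Fin.val_succ]
    by_cases hab : (a : ℕ) = b
    · by_cases h1 : (j : ℕ) = i
      · simp [hab, h1, psq19_neg_one]
      · by_cases h2 : (j : ℕ) = i + 1
        · simp [hab, h2, psq19_X]
        · simp [hab, h1, h2, psq19_zero]
    · simp [hab, Ne.symm hab, psq19_zero]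
  simp only [h, Finset.sum_add_distrib, Finset.sum_ite_eq', Finset.mem_univ, if_true]
  simp
  ring

lemma part_a19 {𝕂 : Type*} [RCLike 𝕂] (m n ε η : ℕ)
    (M : Matrix (Fin (η + 1) × Fin m) (Fin (ε + 1) × Fin n) (Polynomial 𝕂)) :
    polyFrob (blockKron 𝕂 ε n η m M) ^ 2 =
        polyFrob M ^ 2 + 2 * ((n : ℝ) * (ε : ℝ) + (m : ℝ) * (η : ℝ)) := by
  rw [polyFrob_sq19, polyFrob_sq19]
  have h : ∑ i, ∑ j, psq19 (((Lk 𝕂 η).transpose ⊗ₖ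
      (1 : Matrix (Fin m) (Fin m) (Polynomial 𝕂))) i j) = 2 * ((m : ℝ) * η) := by
    rw [← Lk_sum19 (𝕂 := 𝕂), Finset.sum_comm]
    simp [Matrix.kroneckerMap_apply, Matrix.one_apply, eq_comm]
  have h2 := Lk_sum19 (𝕂 := 𝕂) ε n
  simp only [blockKron, Fintype.sum_sum_type, Matrix.fromBlocks_apply₁₁,
    Matrix.fromBlocks_apply₁₂, Matrix.fromBlocks_apply₂₁, Matrix.fromBlocks_apply₂₂,
    Finset.sum_add_distrib, Matrix.zero_apply, psq19_zero, Finset.sum_const_zero]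
  rw [h, h2]
  ring

lemma Q_entry19 {𝕂 : Type*} [RCLike 𝕂] (m n ε η : ℕ)
    (M : Matrix (Fin (η + 1) × Fin m) (Fin (ε + 1) × Fin n) (Polynomial 𝕂))
    (hM : ∀ i j, (M i j).natDegree ≤ 1) (a : Fin 1 × Fin m) (b : Fin 1 × Fin n) :
    QpolyOf 𝕂 ε n η m M a b = ∑ t : (Fin (η + 1) × Fin (ε + 1)) × Fin 2,
      Polynomial.monomial ((η - (t.1.1 : ℕ)) + (ε - (t.1.2 : ℕ)) + (t.2 : ℕ))
        ((M (t.1.1, a.2) (t.1.2, b.2)).coeff t.2) := by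
  have h1 : QpolyOf 𝕂 ε n η m M a b = ∑ j : Fin (ε + 1), ∑ i : Fin (η + 1),
      X ^ (η - (i : ℕ)) * M (i, a.2) (j, b.2) * X ^ (ε - (j : ℕ)) := by
    simp [QpolyOf, Matrix.mul_apply, Fintype.sum_prod_type, Matrix.kroneckerMap_apply, Lam,
      Matrix.one_apply, Finset.sum_mul]
  rw [h1, Finset.sum_comm, Fintype.sum_prod_type, Fintype.sum_prod_type]
  refine Finset.sum_congr rfl fun i _ => Finset.sum_congr rfl fun j _ => ?_
  have h2 := Polynomial.eq_X_add_C_of_natDegree_le_one (hM (i, a.2) (j, b.2))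
  simp only [Fin.sum_univ_two, ← Polynomial.C_mul_X_pow_eq_monomial]
  conv_lhs => rw [h2]
  simp
  ring

lemma part_b19 {𝕂 : Type*} [RCLike 𝕂] (m n ε η : ℕ)
    (M : Matrix (Fin (η + 1) × Fin m) (Fin (ε + 1) × Fin n) (Polynomial 𝕂))
    (hM : ∀ i j, (M i j).natDegree ≤ 1) :
    polyFrob (QpolyOf 𝕂 ε n η m M) ^ 2 ≤ ((2 * (η + 1) : ℕ) : ℝ) * polyFrob M ^ 2 := by
  rw [polyFrob_sq19, polyFrob_sq19]
  have key : ∀ a b, psq19 (QpolyOf 𝕂 ε n η m M a b) ≤ ((2 * (η + 1) : ℕ) : ℝ) *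
      ∑ i : Fin (η + 1), ∑ j : Fin (ε + 1), psq19 (M (i, a.2) (j, b.2)) := by
    intro a b
    rw [Q_entry19 m n ε η M hM]
    refine (psq19_sum _ _ (2 * (η + 1)) ?_).trans (le_of_eq ?_)
    · intro k
      have : (Finset.univ : Finset (Fin (η + 1) × Fin 2)).card = 2 * (η + 1) := by
        simp [mul_comm]
      rw [← this]
      apply Finset.card_le_card_of_injOn (fun t => (t.1.1, t.2)) (by simp)
      rintro ⟨⟨i, j⟩, s⟩ h ⟨⟨i', j'⟩, s'⟩ h' he
      simp at h h' he
      obtain ⟨rfl, rfl⟩ := he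
      have : j = j' := by ext; omega
      rw [this]
    · rw [Fintype.sum_prod_type, Fintype.sum_prod_type]
      simp only [psq19_le_one _ (hM _ _)]
  calc _ ≤ ∑ a : Fin 1 × Fin m, ∑ b : Fin 1 × Fin n, ((2 * (η + 1) : ℕ) : ℝ) *
      ∑ i : Fin (η + 1), ∑ j : Fin (ε + 1), psq19 (M (i, a.2) (j, b.2)) :=
        Finset.sum_le_sum fun a _ => Finset.sum_le_sum fun b _ => key a b
    _ = _ := by
      simp only [← Finset.mul_sum, Fintype.sum_prod_type, Fin.sum_univ_one, Finset.univ_unique,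
        Finset.sum_singleton]
      congr 1
      conv_rhs => rw [Finset.sum_comm]
      refine Finset.sum_congr rfl fun a _ => ?_
      rw [Finset.sum_comm]
      refine Finset.sum_congr rfl fun i _ => ?_
      rw [Finset.sum_comm]

/-- **Lemma `lemm:quotient`.** For the `(ε,n,η,m)`-block Kronecker pencil
`L(λ)` with `(1,1)` block `λM₁+M₀` and `P(λ) = (Λ_ηᵀ⊗I_m)(λM₁+M₀)(Λ_ε⊗I_n)`, `d = ε+η+1`:
(a) `‖L‖_F² = ‖λM₁+M₀‖_F² + 2(nε+mη)`, and (b) `‖P‖_F ≤ √(2d)·‖λM₁+M₀‖_F`; in particular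
`‖L‖_F ≥ ‖P‖_F/√(2d)`. -/
theorem statement_19 {𝕂 : Type*} [RCLike 𝕂] (m n ε η d : ℕ)
    (hm : 1 ≤ m) (hn : 1 ≤ n) (hd : d = ε + η + 1)
    (M : Matrix (Fin (η + 1) × Fin m) (Fin (ε + 1) × Fin n) (Polynomial 𝕂))
    (hM : ∀ i j, (M i j).natDegree ≤ 1) :
    polyFrob (blockKron 𝕂 ε n η m M) ^ 2 =
        polyFrob M ^ 2 + 2 * ((n : ℝ) * (ε : ℝ) + (m : ℝ) * (η : ℝ)) ∧
    polyFrob (QpolyOf 𝕂 ε n η m M) ≤ Real.sqrt (2 * (d : ℝ)) * polyFrob M ∧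
    polyFrob (QpolyOf 𝕂 ε n η m M) / Real.sqrt (2 * (d : ℝ)) ≤
      polyFrob (blockKron 𝕂 ε n η m M) := by
  have ha := part_a19 m n ε η M
  have hb := part_b19 m n ε η M hM
  have h0 : 0 ≤ polyFrob M := Real.sqrt_nonneg _
  have hL : 0 ≤ polyFrob (blockKron 𝕂 ε n η m M) := Real.sqrt_nonneg _
  have hd0 : (0 : ℝ) < 2 * (d : ℝ) := by
    have : 0 < d := by omega
    positivity
  have hs : 0 < Real.sqrt (2 * (d : ℝ)) := Real.sqrt_pos.2 hd0
  have hB : polyFrob (QpolyOf 𝕂 ε n η m M) ≤ Real.sqrt (2 * (d : ℝ)) * polyFrob M := by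
    apply le_of_sq_le_sq19 _ (by positivity)
    rw [mul_pow, Real.sq_sqrt hd0.le]
    refine hb.trans ?_
    gcongr
    have : 2 * (η + 1) ≤ 2 * d := by omega
    exact_mod_cast this
  refine ⟨ha, hB, ?_⟩
  rw [div_le_iff₀ hs, mul_comm]
  refine hB.trans ?_
  gcongr
  apply le_of_sq_le_sq19 _ hL
  rw [ha]
  have : (0 : ℝ) ≤ 2 * ((n : ℝ) * (ε : ℝ) + (m : ℝ) * (η : ℝ)) := by positivity
  linarith
end
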